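/- Let d ≥ 1, m ∈ ℝ, s ∈ ℝ (with NO restriction on s), 0 < q < ∞, and a ∈ S^m_{1,1}. Define the off-diagonal part S^far_a f := Σ_{j,k≥0, |j−k|≥3} T_{a_{j,k}} f for Schwartz f. Then there is a constant C, independent of μ and f, such that for every μ ∈ ℕ and every Schwartz function f: sup_{P∈D_μ} (|P|^{−1} ∫_P Σ_{k=μ}^∞ 2^{skq} |Π_k S^far_a f(x)|^q dx)^{1/q} ≤ C [ sup_{0≤k≤μ−1} 2^{k(s+m)} ‖Π_k f‖_{L^∞} + sup_{R∈D_μ} (|R|^{−1} ∫_R Σ_{k=μ}^∞ 2^{(s+m)kq} |Π_k f(x)|^q dx)^{1/q} ]; consequently ‖S^far_a f‖_{F_∞^{s,q}} ≤ C ‖f‖_{F_∞^{s+m,q}} for arbitrary s ∈ ℝ. -/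

import Mathlib

noncomputable section

open MeasureTheory SchwartzMap Complex RealInnerProductSpace Filter
open scoped ENNReal NNReal ContDiff SchwartzMap

/-- Euclidean space `ℝ^d`. -/
abbrev RD (d : ℕ) : Type := EuclideanSpace ℝ (Fin d)

/-- Tempered distributions on `ℝ^d`. -/
abbrev TD (d : ℕ) : Type := 𝓢(RD d, ℂ) →L[ℂ] ℂ

/-- Fourier transform of a Schwartz function (with the convention
`f̂(ξ) = ∫ f(x) e^{-2πi⟨x,ξ⟩} dx`). -/
def fourierS {d : ℕ} (f : 𝓢(RD d, ℂ)) : 𝓢(RD d, ℂ) :=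
  SchwartzMap.fourierTransformCLM ℂ f

/-- Hörmander symbol class `S^m_{1,1}`: `a` is smooth and
`‖∂_ξ^α ∂_x^β a(x,ξ)‖ ≤ c_{α,β} (1+‖ξ‖)^{m-|α|+|β|}` for all orders of derivatives. -/
def IsSymbolS11 (d : ℕ) (m : ℝ) (a : RD d → RD d → ℂ) : Prop :=
  ContDiff ℝ ∞ (fun p : RD d × RD d => a p.1 p.2) ∧
  ∀ α β : ℕ, ∃ c : ℝ, ∀ x ξ : RD d,
    ‖iteratedFDeriv ℝ α (fun ξ' => iteratedFDeriv ℝ β (fun x' => a x' ξ') x) ξ‖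
      ≤ c * (1 + ‖ξ‖) ^ (m - (α : ℝ) + (β : ℝ))

/-- The pseudo-differential operator `T_a f(x) = ∫ a(x,ξ) f̂(ξ) e^{2πi⟨x,ξ⟩} dξ`
acting on a Schwartz function `f`. -/
def pdo {d : ℕ} (a : RD d → RD d → ℂ) (f : 𝓢(RD d, ℂ)) (x : RD d) : ℂ :=
  ∫ ξ, a x ξ * fourierS f ξ * Complex.exp (2 * Real.pi * Complex.I * ((⟪x, ξ⟫ : ℝ) : ℂ))

/-- Littlewood–Paley data: a Schwartz function `φ` with `φ̂` supported in
`{1/2 ≤ |ξ| ≤ 2}` and `Σ_{k∈ℤ} φ̂(2^{-k}ξ) = 1` for `ξ ≠ 0`, together with the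
low-frequency piece `Φ` determined by `Φ̂ = 1 - Σ_{k≥1} φ̂(2^{-k}·)`. -/
structure LPData (d : ℕ) where
  φ : 𝓢(RD d, ℂ)
  Φ : 𝓢(RD d, ℂ)
  supp_φ : ∀ ξ : RD d, fourierS φ ξ ≠ 0 → 1/2 ≤ ‖ξ‖ ∧ ‖ξ‖ ≤ 2
  sum_φ : ∀ ξ : RD d, ξ ≠ 0 → HasSum (fun k : ℤ => fourierS φ ((2:ℝ)^(-k) • ξ)) 1
  Φ_def : ∀ ξ : RD d, fourierS Φ ξ = 1 - ∑' k : ℕ, fourierS φ (((2:ℝ)^(k+1))⁻¹ • ξ)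

/-- The Littlewood–Paley convolution kernel: `Φ` for `k = 0` and
`φ_k = 2^{kd} φ(2^k ·)` for `k ≥ 1`. -/
def LPkernel {d : ℕ} (D : LPData d) : ℕ → RD d → ℂ
  | 0, x => D.Φ x
  | (k+1), x => (((2:ℝ)^((k+1) * d) : ℝ) : ℂ) * D.φ ((2:ℝ)^(k+1) • x)

/-- The Fourier transform of the `k`-th Littlewood–Paley kernel, i.e. `φ̂_k = φ̂(2^{-k}·)`
for `k ≥ 1` and `Φ̂` for `k = 0`. -/
def LPhat {d : ℕ} (D : LPData d) : ℕ → RD d → ℂ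
  | 0, ξ => fourierS D.Φ ξ
  | (k+1), ξ => fourierS D.φ (((2:ℝ)^(k+1))⁻¹ • ξ)

/-- Littlewood–Paley operator `Π_k g = φ_k ∗ g` (with `φ_0 := Φ`) acting on functions. -/
def LP {d : ℕ} (D : LPData d) (k : ℕ) (g : RD d → ℂ) (x : RD d) : ℂ :=
  ∫ y, LPkernel D k y * g (x - y)

/-- `Π*_k = Π_{k-1} + Π_k + Π_{k+1}` (with the convention `φ_{-1} := 0`). -/
def LPstar {d : ℕ} (D : LPData d) (k : ℕ) (g : RD d → ℂ) (x : RD d) : ℂ :=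
  (if k = 0 then 0 else LP D (k-1) g x) + LP D k g x + LP D (k+1) g x

open Classical in
/-- Pairing of a tempered distribution with a plain function: it gives `u ψ` if the
function is (the coercion of) a Schwartz function `ψ`, and `0` otherwise. -/
def pairing {d : ℕ} (u : TD d) (g : RD d → ℂ) : ℂ :=
  if h : ∃ ψ : 𝓢(RD d, ℂ), ⇑ψ = g then u h.choose else 0

/-- Fourier transform of a tempered distribution, `⟨û, ψ⟩ = ⟨u, ψ̂⟩`. -/
def fourierTD {d : ℕ} (u : TD d) : TD d :=
  u.comp (SchwartzMap.fourierTransformCLM ℂ)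

/-- Littlewood–Paley operator on tempered distributions:
`Π_k u (x) = ⟨u, φ_k(x - ·)⟩`. -/
def LPdist {d : ℕ} (D : LPData d) (k : ℕ) (u : TD d) (x : RD d) : ℂ :=
  pairing u (fun y => LPkernel D k (x - y))

/-- The symbol `a_{j,k}(x,ξ) = (φ_j ∗ a(·,ξ))(x) · φ̂_k(ξ)` (with `Φ` replacing `φ_0`). -/
def symbolPiece {d : ℕ} (D : LPData d) (a : RD d → RD d → ℂ) (j k : ℕ)
    (x ξ : RD d) : ℂ :=
  (∫ y, LPkernel D j y * a (x - y) ξ) * LPhat D k ξ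

/-- `T_{a_{j,k}} u (x) = ⟨û, a_{j,k}(x,·) e^{2πi⟨x,·⟩}⟩` for a tempered distribution `u`. -/
def pdoPieceD {d : ℕ} (D : LPData d) (a : RD d → RD d → ℂ) (j k : ℕ)
    (u : TD d) (x : RD d) : ℂ :=
  pairing (fourierTD u)
    (fun ξ => symbolPiece D a j k x ξ * Complex.exp (2 * Real.pi * Complex.I * ((⟪x, ξ⟫ : ℝ) : ℂ)))

/-- Partial sums `Σ_{j=0}^N Σ_{k=0}^N T_{a_{j,k}} u (x)`. -/
def pdoPartial {d : ℕ} (D : LPData d) (a : RD d → RD d → ℂ) (N : ℕ)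
    (u : TD d) (x : RD d) : ℂ :=
  ∑ j ∈ Finset.range (N+1), ∑ k ∈ Finset.range (N+1), pdoPieceD D a j k u x

/-- `T_a u` converges in `S'` to the tempered distribution `Tf`: the partial sums
`Σ_{j,k≤N} T_{a_{j,k}} u` (which are functions) converge to `Tf` weakly. -/
def ConvergesInSPrime {d : ℕ} (D : LPData d) (a : RD d → RD d → ℂ)
    (u : TD d) (Tf : TD d) : Prop :=
  ∀ ψ : 𝓢(RD d, ℂ),
    Tendsto (fun N => ∫ x, pdoPartial D a N u x * ψ x) atTop (nhds (Tf ψ))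

/-- The dyadic cube of level `ν` (side length `2^{-ν}`) indexed by `n ∈ ℤ^d`. -/
def dyadicCube (d : ℕ) (ν : ℤ) (n : Fin d → ℤ) : Set (RD d) :=
  {x | ∀ i, (n i : ℝ) * (2:ℝ)^(-ν) ≤ x i ∧ x i < ((n i : ℝ) + 1) * (2:ℝ)^(-ν)}

/-- The local quantity `(|P|⁻¹ ∫_P Σ_{k=k₀}^∞ 2^{skq} ‖g_k(x)‖^q dx)^{1/q}` for the
dyadic cube `P` of level `μ` indexed by `n` (so that `|P|⁻¹ = 2^{μd}`). -/
def cubePiece (d : ℕ) (μ : ℕ) (n : Fin d → ℤ) (k₀ : ℕ) (s q : ℝ)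
    (g : ℕ → RD d → ℂ) : ℝ≥0∞ :=
  ((2:ℝ≥0∞)^((μ:ℝ)*(d:ℝ)) *
    ∫⁻ x in dyadicCube d μ n,
      ∑' j : ℕ, (2:ℝ≥0∞)^(s*((k₀:ℝ)+(j:ℝ))*q) * (‖g (k₀+j) x‖₊ : ℝ≥0∞)^q) ^ (1/q)

/-- The `F_∞^{s,q}` norm (for `q < ∞`) of a function, computed from its
Littlewood–Paley pieces:
`‖Π_0 g‖_∞ + sup_{l(P)<1 dyadic} (|P|⁻¹ ∫_P Σ_{k=-log₂ l(P)}^∞ 2^{skq}|Π_k g|^q)^{1/q}`. -/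
def FinftyNormFun {d : ℕ} (D : LPData d) (s q : ℝ) (g : RD d → ℂ) : ℝ≥0∞ :=
  (⨆ x : RD d, (‖LP D 0 g x‖₊ : ℝ≥0∞)) +
  ⨆ (μ : ℕ) (_ : 1 ≤ μ) (n : Fin d → ℤ),
    cubePiece d μ n μ s q (fun k x => LP D k g x)

/-- The `F_∞^{s,q}` norm (for `q < ∞`) of a tempered distribution. -/
def FinftyNormDist {d : ℕ} (D : LPData d) (s q : ℝ) (u : TD d) : ℝ≥0∞ :=
  (⨆ x : RD d, (‖LPdist D 0 u x‖₊ : ℝ≥0∞)) +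
  ⨆ (μ : ℕ) (_ : 1 ≤ μ) (n : Fin d → ℤ),
    cubePiece d μ n μ s q (fun k x => LPdist D k u x)

/-- The (axis-parallel, closed) cube with corner `c` and side length `L`. -/
def cube (d : ℕ) (c : RD d) (L : ℝ) : Set (RD d) :=
  {x | ∀ i, c i ≤ x i ∧ x i ≤ c i + L}

/-- The average of `g` over the cube with corner `c` and side length `L`. -/
def cubeMean {d : ℕ} (c : RD d) (L : ℝ) (g : RD d → ℂ) : ℂ :=
  (L^d)⁻¹ • ∫ x in cube d c L, g x

/-- The `bmo` norm (local BMO):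
`sup_{l(Q)≥1} |Q|⁻¹∫_Q |g| + sup_{l(Q)<1} |Q|⁻¹∫_Q |g - g_Q|`, over all cubes `Q`. -/
def bmoNorm (d : ℕ) (g : RD d → ℂ) : ℝ≥0∞ :=
  (⨆ (c : RD d) (L : ℝ) (_ : 1 ≤ L),
    ENNReal.ofReal ((L^d)⁻¹) * ∫⁻ x in cube d c L, (‖g x‖₊ : ℝ≥0∞)) +
  (⨆ (c : RD d) (L : ℝ) (_ : 0 < L) (_ : L < 1),
    ENNReal.ofReal ((L^d)⁻¹) * ∫⁻ x in cube d c L, (‖g x - cubeMean c L g‖₊ : ℝ≥0∞))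

/-- The Peetre maximal function `𝔐_{σ,R} g(x) = sup_y ‖g(x-y)‖/(1+R‖y‖)^σ`. -/
def peetre {d : ℕ} (σ R : ℝ) (g : RD d → ℂ) (x : RD d) : ℝ≥0∞ :=
  ⨆ y : RD d, (‖g (x - y)‖₊ : ℝ≥0∞) / ENNReal.ofReal ((1 + R * ‖y‖) ^ σ)

/-- `g` has (distributional) Fourier support contained in `K`: the pairing
`⟨ĝ, ψ⟩ = ∫ g · ψ̂` vanishes for every Schwartz `ψ` whose support does not meet `K`. -/
def HasFourierSupportIn {d : ℕ} (g : RD d → ℂ) (K : Set (RD d)) : Prop :=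
  ∀ ψ : 𝓢(RD d, ℂ), tsupport ⇑ψ ∩ K = ∅ → ∫ x, g x * fourierS ψ x = 0

/-- The off-diagonal ("far") part `S^{far}_a f = Σ_{|j-k| ≥ 3} T_{a_{j,k}} f`. -/
def Sfar {d : ℕ} (D : LPData d) (a : RD d → RD d → ℂ) (f : 𝓢(RD d, ℂ)) (x : RD d) : ℂ :=
  ∑' p : ℕ × ℕ,
    if 3 ≤ |(p.1 : ℤ) - (p.2 : ℤ)| then pdo (symbolPiece D a p.1 p.2) f x else 0

namespace FarPart

variable {d : ℕ} {m : ℝ} {a : RD d → RD d → ℂ}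

/-! ### Symbols -/

lemma _root_.IsSymbolS11.contDiff_left (ha : IsSymbolS11 d m a) (ξ : RD d) :
    ContDiff ℝ ∞ (fun x => a x ξ) :=
  ha.1.comp (contDiff_prodMk_left ξ)

lemma _root_.IsSymbolS11.contDiff_right (ha : IsSymbolS11 d m a) (x : RD d) :
    ContDiff ℝ ∞ (a x) :=
  ha.1.comp (contDiff_prodMk_right x)

lemma _root_.IsSymbolS11.continuous (ha : IsSymbolS11 d m a) :
    Continuous (fun p : RD d × RD d => a p.1 p.2) := ha.1.continuous

lemma _root_.IsSymbolS11.exists_norm_le (ha : IsSymbolS11 d m a) :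
    ∃ c : ℝ, 0 ≤ c ∧ ∀ x ξ, ‖a x ξ‖ ≤ c * (1 + ‖ξ‖) ^ m := by
  obtain ⟨c, hc⟩ := ha.2 0 0
  have h : ∀ x ξ, ‖a x ξ‖ ≤ c * (1 + ‖ξ‖) ^ m := by
    intro x ξ
    simpa using hc x ξ
  refine ⟨c, ?_, h⟩
  simpa using (norm_nonneg _).trans (h 0 0)

/-- Bounds for the `ξ`-derivatives of a symbol alone. -/
lemma _root_.IsSymbolS11.exists_norm_iteratedFDeriv_le (ha : IsSymbolS11 d m a) (α : ℕ) :
    ∃ c : ℝ, 0 ≤ c ∧ ∀ x ξ,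
      ‖iteratedFDeriv ℝ α (a x) ξ‖ ≤ c * (1 + ‖ξ‖) ^ (m - α) := by
  obtain ⟨c, hc⟩ := ha.2 α 0
  have h : ∀ x ξ, ‖iteratedFDeriv ℝ α (a x) ξ‖ ≤ c * (1 + ‖ξ‖) ^ (m - α) := by
    intro x ξ
    have := hc x ξ
    have e : (fun ξ' => iteratedFDeriv ℝ 0 (fun x' => a x' ξ') x) =
        (continuousMultilinearCurryFin0 ℝ (RD d) ℂ).symm ∘ (a x) := by
      funext ξ'
      simp [iteratedFDeriv_zero_eq_comp]
    rw [e, LinearIsometryEquiv.norm_iteratedFDeriv_comp_left] at this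
    simpa using this
  refine ⟨c, ?_, h⟩
  simpa using (norm_nonneg _).trans (h 0 0)

lemma contDiff_fderiv_left (ha : ContDiff ℝ ∞ (fun p : RD d × RD d => a p.1 p.2)) (v : RD d) :
    ContDiff ℝ ∞ (fun p : RD d × RD d => fderiv ℝ (fun x => a x p.2) p.1 v) := by
  have h : ContDiff ℝ ∞ (fun p : RD d × RD d => fderiv ℝ (fun x => a x p.2) p.1) := by
    apply ContDiff.fderiv (f := fun (p : RD d × RD d) x => a x p.2) (n := ∞) (m := ∞)
    · exact ha.comp (contDiff_snd.prodMk (contDiff_snd.comp contDiff_fst))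
    · exact contDiff_fst
    · simp
  exact h.clm_apply contDiff_const

lemma contDiff_iteratedFDeriv_left (ha : ContDiff ℝ ∞ (fun p : RD d × RD d => a p.1 p.2))
    (n : ℕ) :
    ContDiff ℝ ∞ (fun p : RD d × RD d => iteratedFDeriv ℝ n (fun x => a x p.2) p.1) := by
  induction n with
  | zero =>
    simp only [iteratedFDeriv_zero_eq_comp]
    exact (continuousMultilinearCurryFin0 ℝ (RD d) ℂ).symm.contDiff.comp ha
  | succ n ih =>
    simp only [iteratedFDeriv_succ_eq_comp_left]
    let L : (RD d →L[ℝ] RD d [×n]→L[ℝ] ℂ) →L[ℝ] RD d [×(n + 1)]→L[ℝ] ℂ :=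
      ((continuousMultilinearCurryLeftEquiv ℝ (fun _ : Fin (n + 1) => RD d)
        ℂ).symm.toContinuousLinearEquiv : _ →L[ℝ] _)
    refine ContDiff.comp (ContinuousLinearMap.contDiff (𝕜 := ℝ)
      (E := RD d →L[ℝ] RD d [×n]→L[ℝ] ℂ) (F := RD d [×(n + 1)]→L[ℝ] ℂ) L) ?_
    apply ContDiff.fderiv (n := ∞) (m := ∞)
      (f := fun (p : RD d × RD d) x => iteratedFDeriv ℝ n (fun x' => a x' p.2) x)
    · exact ih.comp (contDiff_snd.prodMk (contDiff_snd.comp contDiff_fst))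
    · exact contDiff_fst
    · simp

/-- An `x`-derivative raises the order of a symbol by one. -/
lemma _root_.IsSymbolS11.fderiv_left (ha : IsSymbolS11 d m a) (v : RD d) :
    IsSymbolS11 d (m + 1) (fun x ξ => fderiv ℝ (fun x' => a x' ξ) x v) := by
  refine ⟨contDiff_fderiv_left ha.1 v, fun α β => ?_⟩
  obtain ⟨c, hc⟩ := ha.2 α (β + 1)
  let E := RD d
  let L : ContinuousMultilinearMap ℝ (fun _ : Fin (β + 1) => E) ℂ →L[ℝ]
      ContinuousMultilinearMap ℝ (fun _ : Fin β => E) ℂ :=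
    (ContinuousLinearMap.compContinuousMultilinearMapL ℝ (fun _ : Fin β => E) (E →L[ℝ] ℂ) ℂ
      (ContinuousLinearMap.apply ℝ ℂ v)) ∘L
    ((continuousMultilinearCurryRightEquiv' ℝ β E ℂ).toContinuousLinearEquiv :
      ContinuousMultilinearMap ℝ (fun _ : Fin (β + 1) => E) ℂ →L[ℝ]
        ContinuousMultilinearMap ℝ (fun _ : Fin β => E) (E →L[ℝ] ℂ))
  have e : ∀ x ξ, iteratedFDeriv ℝ β (fun x' => fderiv ℝ (fun x'' => a x'' ξ) x' v) x
      = L (iteratedFDeriv ℝ (β + 1) (fun x' => a x' ξ) x) := by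
    intro x ξ
    have h1 : ContDiff ℝ ∞ (fderiv ℝ (fun x'' => a x'' ξ)) :=
      (ha.contDiff_left ξ).fderiv_right (by simp)
    have h2 := (ContinuousLinearMap.apply ℝ ℂ v).iteratedFDeriv_comp_left
      (x := x) (i := β) (n := ∞) h1.contDiffAt (by exact_mod_cast le_top)
    rw [iteratedFDeriv_succ_eq_comp_right]
    simp only [L, ContinuousLinearMap.comp_apply]
    refine h2.trans (Eq.symm ?_)
    exact congrArg (ContinuousLinearMap.compContinuousMultilinearMap
      (ContinuousLinearMap.apply ℝ ℂ v)) ((continuousMultilinearCurryRightEquiv' ℝ β (RD d) ℂ).apply_symm_apply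
        (iteratedFDeriv ℝ β (fderiv ℝ (fun x' => a x' ξ)) x))
  refine ⟨‖L‖ * c, fun x ξ => ?_⟩
  simp only [e]
  have hsm : ContDiff ℝ ∞ (fun ξ' => iteratedFDeriv ℝ (β + 1) (fun x' => a x' ξ') x) :=
    (contDiff_iteratedFDeriv_left ha.1 (β + 1)).comp (contDiff_prodMk_right x)
  have := L.norm_iteratedFDeriv_comp_left (f := fun ξ' => iteratedFDeriv ℝ (β + 1) (fun x' => a x' ξ') x)
    (x := ξ) (N := ∞) hsm.contDiffAt (n := α) (by exact_mod_cast le_top)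
  refine this.trans ?_
  rw [mul_assoc]
  gcongr
  have h3 : m + 1 - (α : ℝ) + β = m - α + (β + 1 : ℕ) := by
    push_cast
    ring
  rw [h3]
  exact hc x ξ

lemma isSymbolS11_one : IsSymbolS11 d 0 (fun _ _ => (1 : ℂ)) := by
  refine ⟨contDiff_const, fun α β => ?_⟩
  rcases Nat.eq_zero_or_pos β with rfl | hβ
  · rcases Nat.eq_zero_or_pos α with rfl | hα
    · exact ⟨1, fun x ξ => by simp⟩
    · refine ⟨0, fun x ξ => ?_⟩
      rw [iteratedFDeriv_const_of_ne hα.ne']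
      simp
  · refine ⟨0, fun x ξ => ?_⟩
    have e : (fun _ : RD d => iteratedFDeriv ℝ β (fun _ : RD d => (1 : ℂ)) x) = fun _ => 0 := by
      rw [iteratedFDeriv_const_of_ne hβ.ne']
      rfl
    rw [e]
    simp

end FarPart

namespace FarPart

variable {d : ℕ} {m : ℝ} {a : RD d → RD d → ℂ}

/-! ### Averaging a symbol against a dilated Schwartz function -/

/-- `∫ ψ(y) a(x - y/t, ξ) dy`, the convolution in `x` of `a` with `t^d ψ(t ·)`. -/
def symConv (ψ : 𝓢(RD d, ℂ)) (a : RD d → RD d → ℂ) (t : ℝ) (x ξ : RD d) : ℂ :=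
  ∫ y, ψ y * a (x - t⁻¹ • y) ξ

lemma integrable_symConv_integrand (ψ : 𝓢(RD d, ℂ)) (ha : IsSymbolS11 d m a) (t : ℝ)
    (x ξ : RD d) : Integrable (fun y => ψ y * a (x - t⁻¹ • y) ξ) := by
  obtain ⟨c, -, hc⟩ := ha.exists_norm_le
  refine ψ.integrable.mul_bdd (c := c * (1 + ‖ξ‖) ^ m) ?_ ?_
  · have := (ha.contDiff_left ξ).continuous
    exact (this.comp (by fun_prop : Continuous fun y : RD d => x - t⁻¹ • y)).aestronglyMeasurable
  · exact Eventually.of_forall fun y => hc _ _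

lemma stronglyMeasurable_symConv (ψ : 𝓢(RD d, ℂ)) (ha : IsSymbolS11 d m a) (t : ℝ) :
    StronglyMeasurable (fun p : RD d × RD d => symConv ψ a t p.1 p.2) := by
  have h : Continuous (fun p : (RD d × RD d) × RD d => ψ p.2 * a (p.1.1 - t⁻¹ • p.2) p.1.2) := by
    have h1 : Continuous (fun p : (RD d × RD d) × RD d => ψ p.2) := ψ.continuous.comp continuous_snd
    refine h1.mul (ha.continuous.comp (?_ : Continuous fun p : (RD d × RD d) × RD d =>
      (p.1.1 - t⁻¹ • p.2, p.1.2)))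
    fun_prop
  exact h.stronglyMeasurable.integral_prod_right

lemma stronglyMeasurable_symConv_right (ψ : 𝓢(RD d, ℂ)) (ha : IsSymbolS11 d m a) (t : ℝ)
    (x : RD d) : StronglyMeasurable (symConv ψ a t x) :=
  (stronglyMeasurable_symConv ψ ha t).comp_measurable measurable_prodMk_left

lemma exists_norm_symConv_le (ψ : 𝓢(RD d, ℂ)) (ha : IsSymbolS11 d m a) :
    ∃ C : ℝ, 0 ≤ C ∧ ∀ t x ξ, ‖symConv ψ a t x ξ‖ ≤ C * (1 + ‖ξ‖) ^ m := by
  obtain ⟨c, hc0, hc⟩ := ha.exists_norm_le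
  refine ⟨(∫ y, ‖ψ y‖) * c, by positivity, fun t x ξ => ?_⟩
  rw [mul_assoc, ← integral_mul_const]
  refine norm_integral_le_of_norm_le (ψ.integrable.norm.mul_const _) ?_
  refine Eventually.of_forall fun y => ?_
  rw [norm_mul]
  gcongr
  exact hc _ _

/-- The Fourier transform of `φ` is supported in the annulus `1/2 ≤ ‖ξ‖ ≤ 2`. -/
def AnnulusSupported (φ : 𝓢(RD d, ℂ)) : Prop :=
  ∀ ξ : RD d, fourierS φ ξ ≠ 0 → 1 / 2 ≤ ‖ξ‖ ∧ ‖ξ‖ ≤ 2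

lemma fourierS_injective : Function.Injective (fourierS : 𝓢(RD d, ℂ) → 𝓢(RD d, ℂ)) := by
  intro f g h
  have h' : FourierTransform.fourier f = (FourierTransform.fourier g : 𝓢(RD d, ℂ)) := h
  have e : ∀ f : 𝓢(RD d, ℂ), FourierTransformInv.fourierInv
      (FourierTransform.fourier f : 𝓢(RD d, ℂ)) = f :=
    fun f => FourierTransform.fourierInv_fourier_eq f
  rw [← e f, h', e]

lemma exists_fourierS_eq (g : 𝓢(RD d, ℂ)) : ∃ f, fourierS f = g :=
  ⟨(FourierTransformInv.fourierInv g : 𝓢(RD d, ℂ)),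
    FourierTransform.fourier_fourierInv_eq (F := 𝓢(RD d, ℂ)) g⟩

/-- A Schwartz function with Fourier support in the annulus is a divergence of such functions. -/
lemma AnnulusSupported.exists_sum_lineDeriv {φ : 𝓢(RD d, ℂ)} (hφ : AnnulusSupported φ) :
    ∃ ψ : Fin d → 𝓢(RD d, ℂ), (∀ i, AnnulusSupported (ψ i)) ∧
      ∀ y, φ y = ∑ i, fderiv ℝ (ψ i) y (EuclideanSpace.single i 1) := by
  classical
  let g : Fin d → RD d → ℂ := fun i ξ =>
    (((ξ i) / ‖ξ‖ ^ 2 : ℝ) : ℂ) * (2 * Real.pi * I)⁻¹ * fourierS φ ξ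
  have hcs : HasCompactSupport (fourierS φ) := by
    refine HasCompactSupport.intro (isCompact_closedBall (0 : RD d) 2) fun ξ hξ => ?_
    by_contra h
    exact hξ (by simpa using (hφ ξ h).2)
  have hg1 : ∀ i, HasCompactSupport (g i) := fun i => hcs.mul_left
  have hg2 : ∀ i, ContDiff ℝ ∞ (g i) := by
    intro i
    rw [contDiff_iff_contDiffAt]
    intro ξ
    by_cases hξ : ξ = 0
    · have : g i =ᶠ[nhds ξ] fun _ => 0 := by
        filter_upwards [Metric.ball_mem_nhds ξ (show (0:ℝ) < 1/2 by norm_num)] with η hη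
        have : fourierS φ η = 0 := by
          by_contra h
          have h1 := (hφ η h).1
          rw [hξ, mem_ball_zero_iff] at hη
          linarith
        simp [g, this]
      exact contDiffAt_const.congr_of_eventuallyEq this
    · have h1 : ContDiffAt ℝ ∞ (fun ξ : RD d => (ξ i) / ‖ξ‖ ^ 2) ξ := by
        refine ContDiffAt.div ?_ ?_ (by simpa using hξ)
        · exact (EuclideanSpace.proj (𝕜 := ℝ) i : RD d →L[ℝ] ℝ).contDiff.contDiffAt
        · exact (contDiff_norm_sq ℝ).contDiffAt
      have h2 : ContDiffAt ℝ ∞ (fun ξ : RD d => (((ξ i) / ‖ξ‖ ^ 2 : ℝ) : ℂ)) ξ :=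
        Complex.ofRealCLM.contDiff.contDiffAt.comp ξ h1
      exact (h2.mul contDiffAt_const).mul ((fourierS φ).smooth _).contDiffAt
  choose ψ hψ using fun i => exists_fourierS_eq ((hg1 i).toSchwartzMap (hg2 i))
  have hψ' : ∀ i ξ, fourierS (ψ i) ξ = g i ξ := fun i ξ => by rw [hψ]; rfl
  refine ⟨ψ, ?_, ?_⟩
  · intro i ξ h
    rw [hψ'] at h
    exact hφ ξ (right_ne_zero_of_mul h)
  · let χ : 𝓢(RD d, ℂ) := ∑ i, LineDeriv.lineDerivOp (EuclideanSpace.single i (1:ℝ)) (ψ i)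
    have : φ = χ := by
      apply fourierS_injective
      ext ξ
      have e1 : fourierS χ = ∑ i, fourierS (LineDeriv.lineDerivOp
          (EuclideanSpace.single i (1:ℝ)) (ψ i)) := by
        simp only [χ, fourierS, map_sum]
      have e2 : ∀ i, fourierS (LineDeriv.lineDerivOp
          (EuclideanSpace.single i (1:ℝ)) (ψ i)) ξ = (2 * Real.pi * I) * ((ξ i : ℂ) * g i ξ) := by
        intro i
        have := SchwartzMap.fourier_lineDerivOp_eq (ψ i) (EuclideanSpace.single i (1:ℝ))
        have h3 := congrArg (fun F : 𝓢(RD d, ℂ) => F ξ) this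
        have htg : (inner ℝ · (EuclideanSpace.single i (1:ℝ)) : RD d → ℝ).HasTemperateGrowth := by
          fun_prop
        rw [← hψ' i ξ]
        refine h3.trans ?_
        rw [_root_.smul_apply, SchwartzMap.smulLeftCLM_apply_apply htg]
        simp only [EuclideanSpace.inner_single_right, smul_eq_mul, one_mul, conj_trivial,
          Complex.real_smul]
        rfl
      rw [e1, _root_.sum_apply]
      simp only [e2]
      by_cases h0 : fourierS φ ξ = 0
      · simp [g, h0]
      · have hn : ‖ξ‖ ≠ 0 := by
          have := (hφ ξ h0).1
          intro h
          rw [h] at this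
          norm_num at this
        have hpi : (2 * Real.pi * I : ℂ) ≠ 0 := by simp [Real.pi_ne_zero]
        have e3 : ∀ i, (2 * Real.pi * I) * ((ξ i : ℂ) * g i ξ) =
            ((ξ i ^ 2 / ‖ξ‖ ^ 2 : ℝ) : ℂ) * fourierS φ ξ := by
          intro i
          simp only [g]
          push_cast
          field_simp
        simp only [e3]
        rw [← Finset.sum_mul, ← Complex.ofReal_sum, ← Finset.sum_div,
          ← EuclideanSpace.real_norm_sq_eq, div_self (pow_ne_zero 2 hn)]
        simp
    intro y
    conv_lhs => rw [this]
    simp only [χ, _root_.sum_apply]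
    rfl

/-- Integration by parts gains a factor `t⁻¹` for Fourier support in the annulus. -/
lemma AnnulusSupported.exists_symConv_eq {φ : 𝓢(RD d, ℂ)} (hφ : AnnulusSupported φ) :
    ∃ ψ : Fin d → 𝓢(RD d, ℂ), (∀ i, AnnulusSupported (ψ i)) ∧
      ∀ (m : ℝ) (a : RD d → RD d → ℂ), IsSymbolS11 d m a → ∀ t x ξ,
        symConv φ a t x ξ = (t⁻¹ : ℝ) * ∑ i, symConv (ψ i)
          (fun x ξ => fderiv ℝ (fun x' => a x' ξ) x (EuclideanSpace.single i 1)) t x ξ := by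
  obtain ⟨ψ, hψ, hsum⟩ := hφ.exists_sum_lineDeriv
  refine ⟨ψ, hψ, fun m a ha t x ξ => ?_⟩
  let e : Fin d → RD d := fun i => EuclideanSpace.single i 1
  let g : RD d → ℂ := fun y => a (x - t⁻¹ • y) ξ
  have hdiff : ∀ y, HasFDerivAt g ((fderiv ℝ (fun x' => a x' ξ) (x - t⁻¹ • y)).comp
      (-(t⁻¹ • ContinuousLinearMap.id ℝ (RD d)))) y := by
    intro y
    have h1 : HasFDerivAt (fun x' => a x' ξ) (fderiv ℝ (fun x' => a x' ξ) (x - t⁻¹ • y))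
        (x - t⁻¹ • y) :=
      ((ha.contDiff_left ξ).differentiable (by simp)).differentiableAt.hasFDerivAt
    have h2 : HasFDerivAt (fun y : RD d => x - t⁻¹ • y)
        (-(t⁻¹ • ContinuousLinearMap.id ℝ (RD d))) y :=
      ((hasFDerivAt_id y).const_smul t⁻¹).const_sub x
    exact h1.comp y h2
  have hg' : ∀ i y, fderiv ℝ g y (e i) =
      -((t⁻¹ : ℝ) * fderiv ℝ (fun x' => a x' ξ) (x - t⁻¹ • y) (e i)) := by
    intro i y
    rw [(hdiff y).fderiv]
    simp
  have h_int : ∀ f : 𝓢(RD d, ℂ), Integrable (fun y => f y * g y) := fun f =>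
    integrable_symConv_integrand f ha t x ξ
  have h_int1 : ∀ i, Integrable (fun y => fderiv ℝ (ψ i) y (e i) * g y) := fun i =>
    h_int (LineDeriv.lineDerivOp (e i) (ψ i))
  have h_int2 : ∀ i, Integrable (fun y => ψ i y * fderiv ℝ g y (e i)) := by
    intro i
    have := (integrable_symConv_integrand (ψ i) (ha.fderiv_left (e i)) t x ξ).const_mul
      (-((t⁻¹ : ℝ) : ℂ))
    refine this.congr (Eventually.of_forall fun y => ?_)
    simp only [hg']
    ring
  calc symConv φ a t x ξ = ∫ y, ∑ i, fderiv ℝ (ψ i) y (e i) * g y := by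
        simp only [symConv, hsum, Finset.sum_mul, e, g]
    _ = ∑ i, ∫ y, fderiv ℝ (ψ i) y (e i) * g y := integral_finsetSum _ fun i _ => h_int1 i
    _ = ∑ i, -∫ y, ψ i y * fderiv ℝ g y (e i) := by
        refine Finset.sum_congr rfl fun i _ => ?_
        rw [integral_mul_fderiv_eq_neg_fderiv_mul_of_integrable (h_int1 i) (h_int2 i) (h_int (ψ i))
          (fun y _ => (ψ i).differentiableAt) (fun y _ => (hdiff y).differentiableAt), neg_neg]
    _ = _ := by
        rw [Finset.mul_sum]
        refine Finset.sum_congr rfl fun i _ => ?_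
        rw [symConv, ← integral_neg, ← integral_const_mul]
        congr 1 with y
        rw [hg']
        ring

/-- Arbitrary decay in `t` of `symConv` for Fourier support in the annulus. -/
lemma AnnulusSupported.exists_norm_symConv_le (M : ℕ) : ∀ {m : ℝ} {a : RD d → RD d → ℂ}
    {φ : 𝓢(RD d, ℂ)}, AnnulusSupported φ → IsSymbolS11 d m a →
    ∃ C : ℝ, 0 ≤ C ∧ ∀ t : ℝ, 0 < t → ∀ x ξ,
      ‖symConv φ a t x ξ‖ ≤ C * (t⁻¹ ^ M * (1 + ‖ξ‖) ^ (m + M)) := by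
  induction M with
  | zero =>
    intro m a φ _ ha
    obtain ⟨C, hC, h⟩ := FarPart.exists_norm_symConv_le φ ha
    exact ⟨C, hC, fun t _ x ξ => by simpa using h t x ξ⟩
  | succ M ih =>
    intro m a φ hφ ha
    obtain ⟨ψ, hψ, hrep⟩ := hφ.exists_symConv_eq
    choose C hC h using fun i => ih (hψ i) (ha.fderiv_left (EuclideanSpace.single i 1))
    refine ⟨∑ i, C i, Finset.sum_nonneg fun i _ => hC i, fun t ht x ξ => ?_⟩
    rw [hrep m a ha, norm_mul, Complex.norm_real, Real.norm_of_nonneg (by positivity)]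
    calc t⁻¹ * ‖∑ i, symConv (ψ i) _ t x ξ‖
        ≤ t⁻¹ * ∑ i, C i * (t⁻¹ ^ M * (1 + ‖ξ‖) ^ (m + 1 + M)) := by
          gcongr
          exact norm_sum_le_of_le _ fun i _ => h i t ht x ξ
      _ = _ := by
          rw [← Finset.sum_mul, show m + 1 + (M : ℝ) = m + (M + 1 : ℕ) by push_cast; ring]
          ring

end FarPart

namespace FarPart

variable {d : ℕ} {m : ℝ} {a : RD d → RD d → ℂ}

/-! ### Smooth frequency cut-offs and kernels -/

/-- A smooth bump equal to `1` for `‖ξ‖ ≤ 2` and vanishing for `‖ξ‖ ≥ 4`. -/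
def lowBump (d : ℕ) : ContDiffBump (0 : RD d) := ⟨2, 4, by norm_num, by norm_num⟩

/-- The profile of the cut-off at level `k`. -/
def cutProfile (d : ℕ) : ℕ → RD d → ℝ
  | 0, ζ => lowBump d ζ
  | _ + 1, ζ => lowBump d ζ - lowBump d ((8 : ℝ) • ζ)

/-- A smooth cut-off equal to `1` on the support of the `k`-th Littlewood–Paley multiplier. -/
def cutoff (d k : ℕ) (ξ : RD d) : ℝ := cutProfile d k (((2 : ℝ) ^ k)⁻¹ • ξ)

lemma contDiff_cutProfile (k : ℕ) : ContDiff ℝ ∞ (cutProfile d k) := by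
  cases k with
  | zero => exact (lowBump d).contDiff
  | succ k =>
    exact (lowBump d).contDiff.sub ((lowBump d).contDiff.comp (contDiff_const_smul (8 : ℝ)))

lemma contDiff_cutoff (k : ℕ) : ContDiff ℝ ∞ (cutoff d k) :=
  (contDiff_cutProfile k).comp (contDiff_const_smul _)

lemma lowBump_eq_zero {ζ : RD d} (h : 4 ≤ ‖ζ‖) : lowBump d ζ = 0 :=
  (lowBump d).zero_of_le_dist (by simpa [lowBump] using h)

lemma lowBump_eq_one {ζ : RD d} (h : ‖ζ‖ ≤ 2) : lowBump d ζ = 1 :=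
  (lowBump d).one_of_mem_closedBall (by simpa [lowBump] using h)

lemma norm_of_cutProfile_ne_zero {k : ℕ} {ζ : RD d} (h : cutProfile d k ζ ≠ 0) :
    ‖ζ‖ ≤ 4 ∧ (1 ≤ k → 1 / 4 ≤ ‖ζ‖) := by
  cases k with
  | zero =>
    refine ⟨?_, by simp⟩
    by_contra! h'
    exact h (lowBump_eq_zero h'.le)
  | succ k =>
    constructor
    · by_contra! h'
      refine h ?_
      simp only [cutProfile]
      rw [lowBump_eq_zero h'.le, lowBump_eq_zero, sub_zero]
      rw [norm_smul, Real.norm_eq_abs, abs_of_pos (by norm_num)]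
      linarith
    · intro _
      by_contra! h'
      refine h ?_
      simp only [cutProfile]
      rw [lowBump_eq_one (by linarith), lowBump_eq_one, sub_self]
      rw [norm_smul, Real.norm_eq_abs, abs_of_pos (by norm_num)]
      linarith

lemma cutProfile_eq_one {k : ℕ} {ζ : RD d} (h : ‖ζ‖ ≤ 2) (h' : 1 ≤ k → 1 / 2 ≤ ‖ζ‖) :
    cutProfile d k ζ = 1 := by
  cases k with
  | zero => exact lowBump_eq_one h
  | succ k =>
    simp only [cutProfile]
    rw [lowBump_eq_one h, lowBump_eq_zero, sub_zero]
    rw [norm_smul, Real.norm_eq_abs, abs_of_pos (by norm_num)]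
    linarith [h' (by simp)]

lemma norm_of_mem_tsupport_cutProfile {k : ℕ} {ζ : RD d} (h : ζ ∈ tsupport (cutProfile d k)) :
    ‖ζ‖ ≤ 4 ∧ (1 ≤ k → 1 / 4 ≤ ‖ζ‖) := by
  have hcl : IsClosed {ζ : RD d | ‖ζ‖ ≤ 4 ∧ (1 ≤ k → 1 / 4 ≤ ‖ζ‖)} := by
    refine (isClosed_le continuous_norm continuous_const).inter ?_
    change IsClosed {ζ : RD d | 1 ≤ k → 1 / 4 ≤ ‖ζ‖}
    by_cases hk : 1 ≤ k
    · simp only [hk, true_imp_iff]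
      exact isClosed_le continuous_const continuous_norm
    · simp [hk]
  exact closure_minimal (fun ζ hζ => norm_of_cutProfile_ne_zero hζ) hcl h

lemma hasCompactSupport_cutProfile (k : ℕ) : HasCompactSupport (cutProfile d k) :=
  HasCompactSupport.intro (isCompact_closedBall (0 : RD d) 4) fun ζ hζ => by
    by_contra h
    exact hζ (by simpa using (norm_of_cutProfile_ne_zero h).1)

lemma hasCompactSupport_cutoff (k : ℕ) : HasCompactSupport (cutoff d k) :=
  (hasCompactSupport_cutProfile k).comp_smul (by positivity)

lemma exists_norm_iteratedFDeriv_cutProfile_le (α : ℕ) :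
    ∃ B : ℝ, 0 ≤ B ∧ ∀ k ζ, ‖iteratedFDeriv ℝ α (cutProfile d k) ζ‖ ≤ B := by
  have h : ∀ k, ∃ B : ℝ, ∀ ζ, ‖iteratedFDeriv ℝ α (cutProfile d k) ζ‖ ≤ B := fun k =>
    ((hasCompactSupport_cutProfile k).iteratedFDeriv α).exists_bound_of_continuous
      ((contDiff_cutProfile k).continuous_iteratedFDeriv (by exact_mod_cast le_top))
  obtain ⟨B0, h0⟩ := h 0
  obtain ⟨B1, h1⟩ := h 1
  refine ⟨max B0 B1, (norm_nonneg _).trans ((h0 0).trans (le_max_left _ _)), fun k ζ => ?_⟩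
  cases k with
  | zero => exact (h0 ζ).trans (le_max_left _ _)
  | succ k => exact (h1 ζ).trans (le_max_right _ _)

/-- Decay of the Fourier transform of a smooth function supported in a ball. -/
lemma exists_norm_fourier_le (N : ℕ) : ∃ C : ℝ, 0 ≤ C ∧ ∀ (G : RD d → ℂ) (B : ℝ),
    ContDiff ℝ ∞ G → (∀ ζ, 4 < ‖ζ‖ → G ζ = 0) →
    (∀ α ≤ N, ∀ ζ, ‖iteratedFDeriv ℝ α G ζ‖ ≤ B) →
    ∀ w, ‖FourierTransform.fourier G w‖ ≤ C * B * (1 + ‖w‖) ^ (-(N : ℝ)) := by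
  let V : ℝ := volume.real (Metric.closedBall (0 : RD d) 4)
  refine ⟨2 ^ N * (V + 2 ^ N * ((N + 1) * V)), by positivity, fun G B hG hsupp hB w => ?_⟩
  have hB0 : 0 ≤ B := (norm_nonneg _).trans (hB 0 (Nat.zero_le _) 0)
  have hcs : HasCompactSupport G := HasCompactSupport.intro (isCompact_closedBall (0 : RD d) 4)
    fun ζ hζ => hsupp ζ (by simpa using hζ)
  have hts : tsupport G ⊆ Metric.closedBall 0 4 := by
    refine closure_minimal (fun ζ hζ => ?_) Metric.isClosed_closedBall
    by_contra h
    exact hζ (hsupp ζ (by simpa using h))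
  have h_int : ∀ α : ℕ, Integrable (iteratedFDeriv ℝ α G) := fun α =>
    (hG.continuous_iteratedFDeriv (by exact_mod_cast le_top)).integrable_of_hasCompactSupport
      (hcs.iteratedFDeriv α)
  have hbd : ∀ α ≤ N, ∫ ζ, ‖iteratedFDeriv ℝ α G ζ‖ ≤ B * V := by
    intro α hα
    have hz : ∀ ζ, ζ ∉ Metric.closedBall (0 : RD d) 4 → ‖iteratedFDeriv ℝ α G ζ‖ = 0 := by
      intro ζ hζ
      have : ζ ∉ Function.support (iteratedFDeriv ℝ α G) := fun h =>
        hζ (hts (support_iteratedFDeriv_subset α h))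
      simpa using this
    rw [← setIntegral_eq_integral_of_forall_compl_eq_zero hz]
    have := norm_setIntegral_le_of_norm_le_const (μ := volume) (C := B)
      (isCompact_closedBall (0 : RD d) 4).measure_lt_top
      (f := fun ζ => ‖iteratedFDeriv ℝ α G ζ‖) (fun ζ _ => by simpa using hB α hα ζ)
    exact (le_abs_self _).trans this
  have key : ∀ n ≤ N, ‖w‖ ^ n * ‖FourierTransform.fourier G w‖ ≤ 2 ^ n * ((n + 1) * (B * V)) := by
    intro n hn
    have := Real.pow_mul_norm_iteratedFDeriv_fourier_le (f := G) (K := 0) (N := ⊤)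
      (by simpa using hG) (fun k n hk _ => by
        have hk0 : k = 0 := by simpa using hk
        subst hk0
        simpa using (h_int n).norm) (k := 0) (n := n) le_rfl le_top w
    simp only [norm_iteratedFDeriv_zero] at this
    refine this.trans ?_
    simp only [pow_zero, one_mul, zero_add, Finset.range_one,
      Finset.singleton_product, Finset.sum_map, Function.Embedding.coeFn_mk, Nat.cast_zero,
      mul_zero]
    gcongr
    calc ∑ x ∈ Finset.range (n + 1), ∫ v, ‖iteratedFDeriv ℝ x G v‖
        ≤ ∑ x ∈ Finset.range (n + 1), B * V := Finset.sum_le_sum fun x hx =>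
          hbd x ((Nat.lt_succ_iff.1 (Finset.mem_range.1 hx)).trans hn)
      _ = _ := by simp
  rw [Real.rpow_neg (by positivity), Real.rpow_natCast, ← div_eq_mul_inv,
    le_div_iff₀ (by positivity)]
  have h0 := key 0 (Nat.zero_le _)
  have hN := key N le_rfl
  simp only [pow_zero, one_mul, Nat.cast_zero, zero_add] at h0
  have hp : (1 + ‖w‖) ^ N ≤ 2 ^ N * (1 + ‖w‖ ^ N) := by
    rcases le_total ‖w‖ 1 with h | h
    · calc (1 + ‖w‖) ^ N ≤ 2 ^ N := by gcongr; linarith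
        _ ≤ _ := le_mul_of_one_le_right (by positivity) (by simp)
    · calc (1 + ‖w‖) ^ N ≤ (2 * ‖w‖) ^ N := by gcongr; linarith
        _ = 2 ^ N * ‖w‖ ^ N := mul_pow _ _ _
        _ ≤ _ := by gcongr; simp
  calc ‖FourierTransform.fourier G w‖ * (1 + ‖w‖) ^ N
      ≤ ‖FourierTransform.fourier G w‖ * (2 ^ N * (1 + ‖w‖ ^ N)) := by gcongr
    _ = 2 ^ N * (‖FourierTransform.fourier G w‖ + ‖w‖ ^ N * ‖FourierTransform.fourier G w‖) := by
        ring
    _ ≤ 2 ^ N * (B * V + 2 ^ N * ((N + 1) * (B * V))) := by gcongr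
    _ = _ := by ring

lemma rpow_le_of_comparable {y A r : ℝ} (hA : 0 < A) (h1 : A / 8 ≤ y) (h2 : y ≤ 8 * A) :
    y ^ r ≤ 8 ^ |r| * A ^ r := by
  have hy : 0 < y := lt_of_lt_of_le (by positivity) h1
  rcases le_total 0 r with hr | hr
  · rw [abs_of_nonneg hr, ← Real.mul_rpow (by norm_num) hA.le]
    exact Real.rpow_le_rpow hy.le h2 hr
  · rw [abs_of_nonpos hr]
    calc y ^ r ≤ (A / 8) ^ r := Real.rpow_le_rpow_of_nonpos (by positivity) h1 hr
      _ = _ := by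
        rw [Real.div_rpow hA.le (by norm_num), Real.rpow_neg (by norm_num)]
        ring

/-- The oscillating factor `e^{2πi⟨x,ξ⟩}`. -/
def osc (x ξ : RD d) : ℂ := Complex.exp (2 * Real.pi * Complex.I * ((⟪x, ξ⟫ : ℝ) : ℂ))

lemma norm_osc (x ξ : RD d) : ‖osc x ξ‖ = 1 := by
  rw [osc, show 2 * (Real.pi : ℂ) * I * ((⟪x, ξ⟫ : ℝ) : ℂ) =
    ((2 * Real.pi * ⟪x, ξ⟫ : ℝ) : ℂ) * I by push_cast; ring, Complex.norm_exp_ofReal_mul_I]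

lemma continuous_osc : Continuous (fun p : RD d × RD d => osc p.1 p.2) := by
  unfold osc
  fun_prop

lemma osc_add (x y ξ : RD d) : osc (x + y) ξ = osc x ξ * osc y ξ := by
  simp only [osc, ← Complex.exp_add, inner_add_left]
  push_cast
  ring_nf

lemma osc_smul_comm (x ξ : RD d) (t : ℝ) : osc x (t • ξ) = osc (t • x) ξ := by
  simp [osc, inner_smul_left, inner_smul_right]

lemma fourier_eq_integral_osc (G : RD d → ℂ) (w : RD d) :
    FourierTransform.fourier G w = ∫ y, osc (-w) y * G y := by
  rw [Real.fourier_eq']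
  congr 1 with y
  simp only [osc, smul_eq_mul]
  congr 2
  rw [inner_neg_left, real_inner_comm]
  push_cast
  ring

/-- The kernel `∫ a(x,ξ) χ_k(ξ) e^{2πi⟨z,ξ⟩} dξ` of a symbol localised at frequency `2^k`. -/
def cutKer (a : RD d → RD d → ℂ) (k : ℕ) (x z : RD d) : ℂ :=
  ∫ ξ, a x ξ * (cutoff d k ξ : ℂ) * osc z ξ

/-- The weight `2^{kd} (1 + 2^k ‖z‖)^{-N}`. -/
def wt (d : ℕ) (N : ℝ) (k : ℕ) (z : RD d) : ℝ :=
  ((2 : ℝ) ^ k) ^ d * (1 + (2 : ℝ) ^ k * ‖z‖) ^ (-N)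

lemma wt_nonneg (N : ℝ) (k : ℕ) (z : RD d) : 0 ≤ wt d N k z := by
  unfold wt; positivity

lemma cutKer_eq_fourier (a : RD d → RD d → ℂ) (k : ℕ) (x z : RD d) :
    cutKer a k x z = ((((2 : ℝ) ^ k) ^ d : ℝ) : ℂ) * FourierTransform.fourier
      (fun ζ => a x ((2 : ℝ) ^ k • ζ) * (cutProfile d k ζ : ℂ)) (-((2 : ℝ) ^ k • z)) := by
  have h := Measure.integral_comp_smul (volume : Measure (RD d))
    (fun ξ => a x ξ * (cutoff d k ξ : ℂ) * osc z ξ) ((2 : ℝ) ^ k)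
  rw [fourier_eq_integral_osc, neg_neg]
  have e : (fun ζ => osc ((2 : ℝ) ^ k • z) ζ *
      (a x ((2 : ℝ) ^ k • ζ) * (cutProfile d k ζ : ℂ))) =
      fun ζ => a x ((2 : ℝ) ^ k • ζ) * (cutoff d k ((2 : ℝ) ^ k • ζ) : ℂ) *
        osc z ((2 : ℝ) ^ k • ζ) := by
    funext ζ
    rw [osc_smul_comm, cutoff, inv_smul_smul₀ (by positivity)]
    ring
  rw [e, h, cutKer, finrank_euclideanSpace_fin, abs_of_pos (by positivity), Complex.real_smul,
    ← mul_assoc, ← Complex.ofReal_mul, mul_inv_cancel₀ (by positivity)]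
  simp

/-- Kernel decay for a symbol localised at frequency `2^k`. -/
lemma exists_norm_cutKer_le (ha : IsSymbolS11 d m a) (N : ℕ) :
    ∃ C : ℝ, 0 ≤ C ∧ ∀ k x z, ‖cutKer a k x z‖ ≤ C * ((2 : ℝ) ^ k) ^ m * wt d N k z := by
  obtain ⟨C₀, hC₀, hF⟩ := exists_norm_fourier_le (d := d) N
  choose c hc0 hc using ha.exists_norm_iteratedFDeriv_le
  choose B hB0 hB using exists_norm_iteratedFDeriv_cutProfile_le (d := d)
  let D : ℕ → ℝ := fun α => ∑ i ∈ Finset.range (α + 1),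
    (α.choose i : ℝ) * (c i * 8 ^ |m - i|) * B (α - i)
  have hD0 : ∀ α, 0 ≤ D α := fun α => Finset.sum_nonneg fun i _ =>
    mul_nonneg (mul_nonneg (by positivity) (mul_nonneg (hc0 i) (by positivity))) (hB0 _)
  let S : ℝ := ∑ α ∈ Finset.range (N + 1), D α
  have hS : ∀ α ≤ N, D α ≤ S := fun α hα =>
    Finset.single_le_sum (f := D) (fun i _ => hD0 i) (Finset.mem_range.2 (Nat.lt_succ_of_le hα))
  have hS0 : 0 ≤ S := Finset.sum_nonneg fun i _ => hD0 i
  refine ⟨C₀ * S, by positivity, fun k x z => ?_⟩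
  have hk : (1 : ℝ) ≤ 2 ^ k := one_le_pow₀ (by norm_num)
  have hax : ContDiff ℝ ∞ (fun ζ => a x ((2 : ℝ) ^ k • ζ)) :=
    (ha.contDiff_right x).comp (contDiff_const_smul _)
  have hcut : ContDiff ℝ ∞ (fun ζ => (cutProfile d k ζ : ℂ)) :=
    Complex.ofRealCLM.contDiff.comp (contDiff_cutProfile k)
  have hG := hF (fun ζ => a x ((2 : ℝ) ^ k • ζ) * (cutProfile d k ζ : ℂ)) (S * ((2 : ℝ) ^ k) ^ m)
    (hax.mul hcut) (fun ζ hζ => by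
      have : cutProfile d k ζ = 0 := by
        by_contra h
        linarith [(norm_of_cutProfile_ne_zero h).1]
      simp [this]) (fun α hα ζ => by
      refine (norm_iteratedFDeriv_mul_le hax hcut ζ (by exact_mod_cast le_top)).trans ?_
      refine le_trans ?_ (mul_le_mul_of_nonneg_right (hS α hα) (by positivity))
      rw [Finset.sum_mul]
      refine Finset.sum_le_sum fun i hi => ?_
      have hcutB : ∀ j, ‖iteratedFDeriv ℝ j (fun ζ => (cutProfile d k ζ : ℂ)) ζ‖ =
          ‖iteratedFDeriv ℝ j (cutProfile d k) ζ‖ := fun j =>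
        Complex.ofRealLI.norm_iteratedFDeriv_comp_left (contDiff_cutProfile k).contDiffAt
          (by exact_mod_cast le_top)
      by_cases hζ : ζ ∈ tsupport (cutProfile d k)
      · obtain ⟨h4, h14⟩ := norm_of_mem_tsupport_cutProfile hζ
        have hcomp : (1 + ‖(2 : ℝ) ^ k • ζ‖) ^ (m - i) ≤ 8 ^ |m - i| * ((2 : ℝ) ^ k) ^ (m - i) := by
          apply rpow_le_of_comparable (by positivity)
          · rw [norm_smul, Real.norm_of_nonneg (by positivity)]
            rcases Nat.eq_zero_or_pos k with rfl | hkpos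
            · simp only [pow_zero, one_mul]
              linarith [norm_nonneg ζ]
            · nlinarith [h14 hkpos]
          · rw [norm_smul, Real.norm_of_nonneg (by positivity)]
            nlinarith
        have h1 : ‖iteratedFDeriv ℝ i (fun ζ => a x ((2 : ℝ) ^ k • ζ)) ζ‖ ≤
            c i * 8 ^ |m - i| * ((2 : ℝ) ^ k) ^ m := by
          rw [iteratedFDeriv_comp_const_smul _ ((ha.contDiff_right x).of_le
            (by exact_mod_cast le_top)), norm_smul, norm_pow, Real.norm_of_nonneg (by positivity)]
          calc ((2 : ℝ) ^ k) ^ i * ‖iteratedFDeriv ℝ i (a x) ((2 : ℝ) ^ k • ζ)‖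
              ≤ ((2 : ℝ) ^ k) ^ i * (c i * (8 ^ |m - i| * ((2 : ℝ) ^ k) ^ (m - i))) := by
                gcongr
                exact (hc i x _).trans (mul_le_mul_of_nonneg_left hcomp (hc0 i))
            _ = _ := by
                rw [Real.rpow_sub (by positivity), Real.rpow_natCast]
                field_simp
        have h2 : ‖iteratedFDeriv ℝ (α - i) (fun ζ => (cutProfile d k ζ : ℂ)) ζ‖ ≤ B (α - i) := by
          rw [hcutB]
          exact hB _ k ζ
        calc _ ≤ (α.choose i : ℝ) * (c i * 8 ^ |m - i| * ((2 : ℝ) ^ k) ^ m) * B (α - i) := by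
              have := hc0 i
              gcongr
          _ = _ := by ring
      · have h2 : ‖iteratedFDeriv ℝ (α - i) (fun ζ => (cutProfile d k ζ : ℂ)) ζ‖ = 0 := by
          rw [hcutB, norm_eq_zero]
          by_contra h
          exact hζ (support_iteratedFDeriv_subset _ h)
        rw [h2, mul_zero]
        have := hc0 i
        have := hB0 (α - i)
        positivity) (-((2 : ℝ) ^ k • z))
  rw [cutKer_eq_fourier, norm_mul, Complex.norm_real, Real.norm_of_nonneg (by positivity)]
  calc _ ≤ ((2 : ℝ) ^ k) ^ d * (C₀ * (S * ((2 : ℝ) ^ k) ^ m) *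
        (1 + ‖-((2 : ℝ) ^ k • z)‖) ^ (-(N : ℝ))) := by gcongr
    _ = _ := by
      rw [norm_neg, norm_smul, Real.norm_of_nonneg (by positivity), wt]
      ring

end FarPart

namespace FarPart

variable {d : ℕ} {m : ℝ} {a : RD d → RD d → ℂ}

/-! ### Dilated Schwartz functions and the Littlewood–Paley kernels -/

/-- The `L^1`-normalised dilation `2^{nd} ψ(2^n ·)`. -/
def dil (ψ : 𝓢(RD d, ℂ)) (n : ℕ) : 𝓢(RD d, ℂ) :=
  ((((2 : ℝ) ^ n) ^ d : ℝ) : ℂ) • SchwartzMap.compCLMOfContinuousLinearEquiv ℂ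
    (ContinuousLinearEquiv.smulLeft (Units.mk0 ((2 : ℝ) ^ n) (by positivity))) ψ

lemma dil_apply (ψ : 𝓢(RD d, ℂ)) (n : ℕ) (x : RD d) :
    dil ψ n x = ((((2 : ℝ) ^ n) ^ d : ℝ) : ℂ) * ψ ((2 : ℝ) ^ n • x) := rfl

/-- Change of variables for dilated Schwartz functions. -/
lemma integral_dil_mul (ψ : 𝓢(RD d, ℂ)) (n : ℕ) (g : RD d → ℂ) :
    ∫ y, dil ψ n y * g y = ∫ y, ψ y * g (((2 : ℝ) ^ n)⁻¹ • y) := by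
  have h := Measure.integral_comp_smul (volume : Measure (RD d))
    (fun y => ψ y * g (((2 : ℝ) ^ n)⁻¹ • y)) ((2 : ℝ) ^ n)
  simp only [inv_smul_smul₀ (show ((2 : ℝ) ^ n) ≠ 0 by positivity)] at h
  simp only [dil_apply, mul_assoc]
  rw [integral_const_mul, h, finrank_euclideanSpace_fin, abs_of_pos (by positivity),
    Complex.real_smul, ← mul_assoc, ← Complex.ofReal_mul, mul_inv_cancel₀ (by positivity)]
  simp

lemma fourierS_eq_integral (ψ : 𝓢(RD d, ℂ)) (ξ : RD d) :
    fourierS ψ ξ = ∫ y, ψ y * osc (-y) ξ := by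
  change FourierTransform.fourier (ψ : RD d → ℂ) ξ = _
  rw [fourier_eq_integral_osc]
  congr 1 with y
  simp only [osc, inner_neg_left, real_inner_comm ξ y]
  ring

lemma eq_integral_fourierS (ψ : 𝓢(RD d, ℂ)) (x : RD d) :
    ψ x = ∫ ξ, fourierS ψ ξ * osc x ξ := by
  have e : FourierTransformInv.fourierInv
      (FourierTransform.fourier ψ : 𝓢(RD d, ℂ)) = ψ := FourierTransform.fourierInv_fourier_eq ψ
  conv_lhs => rw [← e]
  rw [SchwartzMap.fourierInv_coe]
  rw [Real.fourierInv_eq']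
  congr 1 with y
  simp only [osc, smul_eq_mul, real_inner_comm x y, mul_comm (fourierS ψ y)]
  congr 2
  push_cast
  ring

lemma fourierS_dil (ψ : 𝓢(RD d, ℂ)) (n : ℕ) (ξ : RD d) :
    fourierS (dil ψ n) ξ = fourierS ψ (((2 : ℝ) ^ n)⁻¹ • ξ) := by
  rw [fourierS_eq_integral, integral_dil_mul ψ n (fun y => osc (-y) ξ), fourierS_eq_integral]
  simp only [osc_smul_comm, smul_neg]

lemma symConv_eq_integral_dil (ψ : 𝓢(RD d, ℂ)) (a : RD d → RD d → ℂ) (n : ℕ) (x ξ : RD d) :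
    symConv ψ a (2 ^ n) x ξ = ∫ y, dil ψ n y * a (x - y) ξ :=
  (integral_dil_mul ψ n (fun y => a (x - y) ξ)).symm

/-- The Schwartz function generating the `k`-th Littlewood–Paley kernel. -/
def lpProfile (D : LPData d) : ℕ → 𝓢(RD d, ℂ)
  | 0 => D.Φ
  | _ + 1 => D.φ

/-- The `k`-th Littlewood–Paley kernel as a Schwartz function. -/
def lpKer (D : LPData d) (k : ℕ) : 𝓢(RD d, ℂ) := dil (lpProfile D k) k

lemma LPkernel_eq (D : LPData d) (k : ℕ) (x : RD d) : LPkernel D k x = lpKer D k x := by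
  cases k with
  | zero => simp [LPkernel, lpKer, dil_apply, lpProfile]
  | succ k => simp only [LPkernel, lpKer, dil_apply, lpProfile, pow_mul]

lemma fourierS_lpKer (D : LPData d) (k : ℕ) (ξ : RD d) : fourierS (lpKer D k) ξ = LPhat D k ξ := by
  rw [lpKer, fourierS_dil]
  cases k with
  | zero => simp [LPhat, lpProfile]
  | succ k => rfl

lemma symbolPiece_eq (D : LPData d) (a : RD d → RD d → ℂ) (j k : ℕ) (x ξ : RD d) :
    symbolPiece D a j k x ξ = symConv (lpProfile D j) a (2 ^ j) x ξ * LPhat D k ξ := by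
  simp only [symbolPiece, symConv_eq_integral_dil, LPkernel_eq, lpKer]

lemma LP_eq_integral (D : LPData d) (k : ℕ) (g : RD d → ℂ) (x : RD d) :
    LP D k g x = ∫ y, lpKer D k y * g (x - y) := by
  simp only [LP, LPkernel_eq]

lemma annulusSupported_φ (D : LPData d) : AnnulusSupported D.φ := D.supp_φ

lemma fourierS_φ_eq_zero_of_gt (D : LPData d) {ξ : RD d} (h : 2 < ‖ξ‖) : fourierS D.φ ξ = 0 := by
  by_contra h'
  linarith [(D.supp_φ ξ h').2]

lemma fourierS_φ_eq_zero_of_lt (D : LPData d) {ξ : RD d} (h : ‖ξ‖ < 1 / 2) :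
    fourierS D.φ ξ = 0 := by
  by_contra h'
  linarith [(D.supp_φ ξ h').1]

lemma summable_fourierS_φ (D : LPData d) (ξ : RD d) :
    Summable (fun k : ℕ => fourierS D.φ (((2 : ℝ) ^ (k + 1))⁻¹ • ξ)) := by
  obtain ⟨n, hn⟩ := pow_unbounded_of_one_lt (2 * ‖ξ‖) (one_lt_two : (1 : ℝ) < 2)
  refine summable_of_hasFiniteSupport ((Set.finite_lt_nat n).subset fun k hk => ?_)
  by_contra h
  refine hk (fourierS_φ_eq_zero_of_lt D ?_)
  simp only [Set.mem_ofPred_eq, not_lt] at h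
  have h2 : (2 : ℝ) ^ n ≤ 2 ^ (k + 1) := pow_le_pow_right₀ (by norm_num) (by omega)
  rw [norm_smul, norm_inv, Real.norm_of_nonneg (by positivity), inv_mul_lt_iff₀ (by positivity)]
  linarith

lemma fourierS_Φ_half (D : LPData d) (ξ : RD d) :
    fourierS D.Φ ((2 : ℝ)⁻¹ • ξ) = fourierS D.Φ ξ + fourierS D.φ ((2 : ℝ)⁻¹ • ξ) := by
  rw [D.Φ_def, D.Φ_def, (summable_fourierS_φ D ξ).tsum_eq_zero_add]
  have : ∀ k : ℕ, ((2 : ℝ) ^ (k + 1))⁻¹ • (2 : ℝ)⁻¹ • ξ = ((2 : ℝ) ^ (k + 1 + 1))⁻¹ • ξ := by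
    intro k
    rw [smul_smul, ← mul_inv, pow_succ (2 : ℝ) (k + 1)]
  simp only [this, zero_add, pow_one]
  ring

lemma sum_LPhat (D : LPData d) (J : ℕ) (ξ : RD d) :
    ∑ j ∈ Finset.range (J + 1), LPhat D j ξ = fourierS D.Φ (((2 : ℝ) ^ J)⁻¹ • ξ) := by
  induction J with
  | zero => simp [LPhat]
  | succ J ih =>
    rw [Finset.sum_range_succ, ih]
    have h := fourierS_Φ_half D (((2 : ℝ) ^ J)⁻¹ • ξ)
    rw [smul_smul, ← mul_inv, ← pow_succ'] at h
    rw [h]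
    rfl

lemma sum_lpKer (D : LPData d) (J : ℕ) : ∑ j ∈ Finset.range (J + 1), lpKer D j = dil D.Φ J := by
  apply fourierS_injective
  ext ξ
  rw [fourierS_dil, ← sum_LPhat]
  simp only [← fourierS_lpKer, fourierS, map_sum, _root_.sum_apply]

lemma sum_symConv (D : LPData d) (ha : IsSymbolS11 d m a) (J : ℕ) (x ξ : RD d) :
    ∑ j ∈ Finset.range (J + 1), symConv (lpProfile D j) a (2 ^ j) x ξ =
      symConv D.Φ a (2 ^ J) x ξ := by
  simp only [symConv_eq_integral_dil, ← sum_lpKer, _root_.sum_apply, Finset.sum_mul]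
  rw [integral_finsetSum]
  · rfl
  · intro j _
    have h := integrable_symConv_integrand (lpKer D j) ha 1 x ξ
    simpa using h

lemma fourierS_Φ_eq_zero (D : LPData d) {ξ : RD d} (h : 2 < ‖ξ‖) : fourierS D.Φ ξ = 0 := by
  have h0 : ξ ≠ 0 := by rintro rfl; simp at h; linarith
  have hs := D.sum_φ ξ h0
  have hinj : Function.Injective (fun k : ℕ => ((k : ℤ) + 1)) := fun a b h => by simpa using h
  have hs2 := (hinj.hasSum_iff (f := fun k : ℤ => fourierS D.φ ((2 : ℝ) ^ (-k) • ξ)) (a := 1)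
    (fun k hk => by
      apply fourierS_φ_eq_zero_of_gt
      have hk0 : k ≤ 0 := by
        by_contra hk0
        exact hk ⟨(k - 1).toNat, by simp; omega⟩
      rw [norm_smul, norm_zpow, Real.norm_of_nonneg (by norm_num)]
      have : (1 : ℝ) ≤ 2 ^ (-k) := one_le_zpow₀ (by norm_num) (by omega)
      nlinarith)).2 hs
  rw [D.Φ_def]
  have e : ∀ k : ℕ, ((2 : ℝ) ^ (k + 1))⁻¹ = (2 : ℝ) ^ (-((k : ℤ) + 1)) := fun k => by
    rw [zpow_neg]
    norm_cast
  simp only [e]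
  rw [show (∑' k : ℕ, fourierS D.φ ((2 : ℝ) ^ (-((k : ℤ) + 1)) • ξ)) = 1 from hs2.tsum_eq, sub_self]

lemma norm_of_LPhat_ne_zero (D : LPData d) {k : ℕ} {ξ : RD d} (h : LPhat D k ξ ≠ 0) :
    ‖((2 : ℝ) ^ k)⁻¹ • ξ‖ ≤ 2 ∧ (1 ≤ k → 1 / 2 ≤ ‖((2 : ℝ) ^ k)⁻¹ • ξ‖) := by
  cases k with
  | zero =>
    refine ⟨?_, by simp⟩
    by_contra! h'
    exact h (fourierS_Φ_eq_zero D (by simpa using h'))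
  | succ k => exact ⟨(D.supp_φ _ h).2, fun _ => (D.supp_φ _ h).1⟩

lemma norm_le_of_LPhat_ne_zero (D : LPData d) {k : ℕ} {ξ : RD d} (h : LPhat D k ξ ≠ 0) :
    ‖ξ‖ ≤ 2 * 2 ^ k := by
  have := (norm_of_LPhat_ne_zero D h).1
  rwa [norm_smul, norm_inv, Real.norm_of_nonneg (by positivity), inv_mul_le_iff₀ (by positivity),
    mul_comm] at this

lemma le_norm_of_LPhat_ne_zero (D : LPData d) {k : ℕ} (hk : 1 ≤ k) {ξ : RD d}
    (h : LPhat D k ξ ≠ 0) : 2 ^ k ≤ 2 * ‖ξ‖ := by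
  have := (norm_of_LPhat_ne_zero D h).2 hk
  rw [norm_smul, norm_inv, Real.norm_of_nonneg (by positivity), le_inv_mul_iff₀ (by positivity)]
    at this
  linarith

lemma cutoff_mul_LPhat (D : LPData d) (k : ℕ) (ξ : RD d) :
    (cutoff d k ξ : ℂ) * LPhat D k ξ = LPhat D k ξ := by
  by_cases h : LPhat D k ξ = 0
  · simp [h]
  · obtain ⟨h1, h2⟩ := norm_of_LPhat_ne_zero D h
    rw [cutoff, cutProfile_eq_one h1 h2]
    simp

/-- The `k`-th Littlewood–Paley piece of a Schwartz function, as a Schwartz function. -/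
lemma exists_lpPiece (D : LPData d) (f : 𝓢(RD d, ℂ)) (k : ℕ) :
    ∃ h : 𝓢(RD d, ℂ), (∀ x, h x = LP D k f x) ∧
      ∀ ξ, fourierS h ξ = LPhat D k ξ * fourierS f ξ := by
  refine ⟨SchwartzMap.convolution (ContinuousLinearMap.mul ℂ ℂ) (lpKer D k) f, fun x => ?_,
    fun ξ => ?_⟩
  · rw [LP_eq_integral, SchwartzMap.convolution_apply]
    rfl
  · rw [← fourierS_lpKer]
    exact congrArg (fun g : 𝓢(RD d, ℂ) => g ξ)
      (SchwartzMap.fourier_convolution (ContinuousLinearMap.mul ℂ ℂ) (lpKer D k) f)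

end FarPart

namespace FarPart

variable {d : ℕ} {m : ℝ} {a : RD d → RD d → ℂ}

/-! ### Kernels of averaged symbols -/

lemma continuous_cutoff (k : ℕ) : Continuous (cutoff d k) := (contDiff_cutoff k).continuous

lemma integrable_weight_cutoff (k : ℕ) (r C : ℝ) :
    Integrable (fun ξ : RD d => C * (1 + ‖ξ‖) ^ r * ‖(cutoff d k ξ : ℂ)‖) := by
  refine Continuous.integrable_of_hasCompactSupport ?_ ?_
  · have h : Continuous (fun ξ : RD d => (1 + ‖ξ‖) ^ r) :=
      Continuous.rpow_const (by fun_prop) fun ξ => Or.inl (by positivity)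
    have := continuous_cutoff (d := d) k
    fun_prop
  · refine HasCompactSupport.mul_left ?_
    simpa using (hasCompactSupport_cutoff (d := d) k).norm

lemma integrable_mul_cutoff {b : RD d → ℂ} {r C : ℝ} (hb : StronglyMeasurable b)
    (hC : ∀ ξ, ‖b ξ‖ ≤ C * (1 + ‖ξ‖) ^ r) (k : ℕ) :
    Integrable (fun ξ => b ξ * (cutoff d k ξ : ℂ)) := by
  refine (integrable_weight_cutoff k r C).mono' ?_ (Eventually.of_forall fun ξ => ?_)
  · have := continuous_cutoff (d := d) k
    exact hb.aestronglyMeasurable.mul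
      (by fun_prop : Continuous fun ξ : RD d => (cutoff d k ξ : ℂ)).aestronglyMeasurable
  · rw [norm_mul]
    gcongr
    exact hC ξ

lemma continuous_osc_right (x : RD d) : Continuous (osc x) :=
  continuous_osc.comp (by fun_prop : Continuous fun ξ : RD d => (x, ξ))

lemma _root_.MeasureTheory.Integrable.mul_osc {b : RD d → ℂ} (hb : Integrable b) (z : RD d) :
    Integrable (fun ξ => b ξ * osc z ξ) :=
  hb.mul_bdd (c := 1) (continuous_osc_right z).aestronglyMeasurable
    (Eventually.of_forall fun ξ => (norm_osc z ξ).le)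

lemma integrable_symConv_mul_cutoff (ψ : 𝓢(RD d, ℂ)) (ha : IsSymbolS11 d m a) (t : ℝ)
    (k : ℕ) (x : RD d) : Integrable (fun ξ => symConv ψ a t x ξ * (cutoff d k ξ : ℂ)) := by
  obtain ⟨C, -, hC⟩ := exists_norm_symConv_le ψ ha
  exact integrable_mul_cutoff (stronglyMeasurable_symConv_right ψ ha t x) (fun ξ => hC t x ξ) k

lemma cutKer_symConv (ψ : 𝓢(RD d, ℂ)) (ha : IsSymbolS11 d m a) (t : ℝ) (k : ℕ) (x z : RD d) :
    cutKer (symConv ψ a t) k x z = ∫ y, ψ y * cutKer a k (x - t⁻¹ • y) z := by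
  obtain ⟨c, -, hc⟩ := ha.exists_norm_le
  simp only [cutKer, symConv, ← integral_mul_const, ← integral_const_mul]
  rw [integral_integral_swap]
  · simp only [mul_assoc]
  · have hi := (integrable_weight_cutoff (d := d) k m c).mul_prod (ψ.integrable (μ := volume)).norm
    refine hi.mono' ?_ (Eventually.of_forall fun p => ?_)
    · have h1 := continuous_cutoff (d := d) k
      have h2 := ψ.continuous
      have h3 := ha.continuous.comp
        (by fun_prop : Continuous fun p : RD d × RD d => (x - t⁻¹ • p.2, p.1))
      have h4 := continuous_osc_right z
      refine Continuous.aestronglyMeasurable ?_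
      exact (((h2.comp continuous_snd).mul h3).mul
        (Complex.continuous_ofReal.comp (h1.comp continuous_fst))).mul (h4.comp continuous_fst)
    · simp only [Function.uncurry, norm_mul, norm_osc, mul_one]
      calc ‖ψ p.2‖ * ‖a (x - t⁻¹ • p.2) p.1‖ * ‖(cutoff d k p.1 : ℂ)‖
          ≤ ‖ψ p.2‖ * (c * (1 + ‖p.1‖) ^ m) * ‖(cutoff d k p.1 : ℂ)‖ := by
            gcongr
            exact hc _ _
        _ = _ := by ring

lemma exists_norm_cutKer_symConv_le (ψ : 𝓢(RD d, ℂ)) (ha : IsSymbolS11 d m a) (N : ℕ) :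
    ∃ C : ℝ, 0 ≤ C ∧ ∀ t k x z,
      ‖cutKer (symConv ψ a t) k x z‖ ≤ C * ((2 : ℝ) ^ k) ^ m * wt d N k z := by
  obtain ⟨C, hC0, hC⟩ := exists_norm_cutKer_le ha N
  refine ⟨(∫ y, ‖ψ y‖) * C, by positivity, fun t k x z => ?_⟩
  rw [cutKer_symConv ψ ha, mul_assoc, mul_assoc, ← integral_mul_const]
  refine norm_integral_le_of_norm_le (ψ.integrable.norm.mul_const _) ?_
  refine Eventually.of_forall fun y => ?_
  rw [norm_mul, ← mul_assoc C]
  gcongr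
  exact hC _ _ _

/-- Averaging against an annulus-supported function at scale `t` gains `(2^k/t)^M`. -/
lemma AnnulusSupported.exists_norm_cutKer_symConv_le (N M : ℕ) :
    ∀ {m : ℝ} {a : RD d → RD d → ℂ} {φ : 𝓢(RD d, ℂ)}, AnnulusSupported φ → IsSymbolS11 d m a →
    ∃ C : ℝ, 0 ≤ C ∧ ∀ t : ℝ, 0 < t → ∀ k x z,
      ‖cutKer (symConv φ a t) k x z‖ ≤
        C * (t⁻¹ ^ M * ((2 : ℝ) ^ k) ^ (m + M)) * wt d N k z := by
  induction M with
  | zero =>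
    intro m a φ _ ha
    obtain ⟨C, hC, h⟩ := FarPart.exists_norm_cutKer_symConv_le φ ha N
    exact ⟨C, hC, fun t _ k x z => by simpa using h t k x z⟩
  | succ M ih =>
    intro m a φ hφ ha
    obtain ⟨ψ, hψ, hrep⟩ := hφ.exists_symConv_eq
    choose C hC h using fun i => ih (hψ i) (ha.fderiv_left (EuclideanSpace.single i 1))
    refine ⟨∑ i, C i, Finset.sum_nonneg fun i _ => hC i, fun t ht k x z => ?_⟩
    have e : cutKer (symConv φ a t) k x z = (t⁻¹ : ℝ) * ∑ i, cutKer (symConv (ψ i)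
        (fun x ξ => fderiv ℝ (fun x' => a x' ξ) x (EuclideanSpace.single i 1)) t) k x z := by
      simp only [cutKer]
      rw [← integral_finsetSum _ fun i _ => (integrable_symConv_mul_cutoff (ψ i)
        (ha.fderiv_left (EuclideanSpace.single i 1)) t k x).mul_osc z, ← integral_const_mul]
      congr 1 with ξ
      rw [hrep m a ha, ← Finset.sum_mul, ← Finset.sum_mul]
      ring
    rw [e, norm_mul, Complex.norm_real, Real.norm_of_nonneg (by positivity)]
    calc t⁻¹ * ‖∑ i, cutKer (symConv (ψ i) _ t) k x z‖
        ≤ t⁻¹ * ∑ i, C i * (t⁻¹ ^ M * ((2 : ℝ) ^ k) ^ (m + 1 + M)) * wt d N k z := by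
          gcongr
          exact norm_sum_le_of_le _ fun i _ => h i t ht k x z
      _ = _ := by
          rw [← Finset.sum_mul, ← Finset.sum_mul,
            show m + 1 + (M : ℝ) = m + (M + 1 : ℕ) by push_cast; ring]
          ring

/-- Kernel representation of a frequency-localised multiplier acting on a Schwartz function. -/
lemma integral_mul_cutoff_fourierS {b : RD d → ℂ} {k : ℕ}
    (hb : Integrable (fun ξ => b ξ * (cutoff d k ξ : ℂ))) (h : 𝓢(RD d, ℂ)) (x : RD d) :
    ∫ ξ, b ξ * (cutoff d k ξ : ℂ) * fourierS h ξ * osc x ξ =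
      ∫ y, h y * ∫ ξ, b ξ * (cutoff d k ξ : ℂ) * osc (x - y) ξ := by
  have e : ∀ y ξ, osc (x - y) ξ = osc (-y) ξ * osc x ξ := fun y ξ => by
    rw [← osc_add, neg_add_eq_sub]
  simp only [fourierS_eq_integral, e, ← integral_const_mul, ← integral_mul_const]
  rw [integral_integral_swap]
  · congr 1 with y
    congr 1 with ξ
    ring
  · refine (hb.mul_prod (h.integrable (μ := volume))).norm.mono' ?_ (Eventually.of_forall fun p => ?_)
    · have h4 := (continuous_osc_right x).comp (continuous_fst (X := RD d) (Y := RD d))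
      have h5 := continuous_osc.comp (by fun_prop : Continuous fun p : RD d × RD d => (-p.2, p.1))
      have h6 := (hb.mul_prod (h.integrable (μ := volume))).aestronglyMeasurable
      refine (h6.mul (h5.mul h4).aestronglyMeasurable).congr (Eventually.of_forall fun p => ?_)
      simp only [Function.uncurry, Function.comp, Pi.mul_apply]
      ring
    · simp only [Function.uncurry, norm_mul, norm_osc, mul_one]
      exact le_rfl

lemma pdo_symConv_eq (D : LPData d) (ψ : 𝓢(RD d, ℂ)) (ha : IsSymbolS11 d m a) (t : ℝ) (k : ℕ)
    {f h : 𝓢(RD d, ℂ)} (hf : ∀ ξ, fourierS h ξ = LPhat D k ξ * fourierS f ξ) (x : RD d) :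
    pdo (fun x ξ => symConv ψ a t x ξ * LPhat D k ξ) f x =
      ∫ y, h y * cutKer (symConv ψ a t) k x (x - y) := by
  simp only [cutKer, pdo]
  rw [← integral_mul_cutoff_fourierS (integrable_symConv_mul_cutoff ψ ha t k x) h x]
  congr 1 with ξ
  rw [hf]
  conv_lhs => rw [← cutoff_mul_LPhat]
  simp only [osc]
  ring

/-- Reproducing formula for frequency-localised Schwartz functions. -/
lemma eq_integral_cutKer_one (D : LPData d) (k : ℕ)
    {f h : 𝓢(RD d, ℂ)} (hf : ∀ ξ, fourierS h ξ = LPhat D k ξ * fourierS f ξ) (x : RD d) :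
    h x = ∫ y, h y * cutKer (fun _ _ => 1) k x (x - y) := by
  simp only [cutKer]
  rw [← integral_mul_cutoff_fourierS (integrable_mul_cutoff (r := 0) (C := 1)
    stronglyMeasurable_const (by simp) k) h x, eq_integral_fourierS h x]
  congr 1 with ξ
  rw [hf]
  conv_lhs => rw [← cutoff_mul_LPhat]
  ring

end FarPart

namespace FarPart

variable {d : ℕ} {m : ℝ} {a : RD d → RD d → ℂ}

/-! ### Peetre maximal functions -/

lemma wt_eq_dilation (N : ℝ) (k : ℕ) (z : RD d) :
    wt d N k z = ((2 : ℝ) ^ k) ^ d * (1 + ‖(2 : ℝ) ^ k • z‖) ^ (-N) := by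
  rw [wt, norm_smul, Real.norm_of_nonneg (by positivity)]

/-- The mass of the weight `wt d N k`, which does not depend on `k`. -/
def wtMass (d : ℕ) (N : ℝ) : ℝ := ∫ z : RD d, (1 + ‖z‖) ^ (-N)

lemma wtMass_nonneg (N : ℝ) : 0 ≤ wtMass d N := integral_nonneg fun z => by positivity

lemma integrable_wt {N : ℝ} (hN : d < N) (k : ℕ) : Integrable (wt d N k) := by
  have h : Integrable (fun z : RD d => (1 + ‖z‖) ^ (-N)) :=
    integrable_one_add_norm (by simpa using hN)
  have h2 := (h.comp_smul (show (2 : ℝ) ^ k ≠ 0 by positivity)).const_mul (((2 : ℝ) ^ k) ^ d)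
  exact h2.congr (Eventually.of_forall fun z => (wt_eq_dilation N k z).symm)

lemma integral_wt (N : ℝ) (k : ℕ) : ∫ z, wt d N k z = wtMass d N := by
  simp only [wt_eq_dilation]
  rw [integral_const_mul, Measure.integral_comp_smul (volume : Measure (RD d))
    (fun z => (1 + ‖z‖) ^ (-N)), finrank_euclideanSpace_fin, abs_of_pos (by positivity),
    smul_eq_mul, ← mul_assoc, mul_inv_cancel₀ (by positivity), one_mul, wtMass]

lemma one_add_mul_norm_le (k : ℕ) (x y : RD d) :
    1 + (2 : ℝ) ^ k * ‖x + y‖ ≤ (1 + 2 ^ k * ‖x‖) * (1 + 2 ^ k * ‖y‖) := by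
  have h : (2 : ℝ) ^ k * ‖x + y‖ ≤ 2 ^ k * (‖x‖ + ‖y‖) := by gcongr; exact norm_add_le _ _
  have h2 : 0 ≤ (2 : ℝ) ^ k * ‖x‖ * (2 ^ k * ‖y‖) := by positivity
  nlinarith

lemma wt_anti {N N' : ℝ} (h : N ≤ N') (k : ℕ) (z : RD d) : wt d N' k z ≤ wt d N k z := by
  unfold wt
  gcongr
  have : 0 ≤ (2 : ℝ) ^ k * ‖z‖ := by positivity
  linarith

lemma wt_mul_rpow (N σ : ℝ) (k : ℕ) (z : RD d) :
    wt d N k z * (1 + (2 : ℝ) ^ k * ‖z‖) ^ σ = wt d (N - σ) k z := by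
  rw [wt, wt, mul_assoc, ← Real.rpow_add (by positivity)]
  ring_nf

/-- The Peetre maximal function at frequency `2^k`. -/
def peetreFun (σ : ℝ) (k : ℕ) (h : RD d → ℂ) (x : RD d) : ℝ :=
  ⨆ z : RD d, ‖h (x - z)‖ * (1 + (2 : ℝ) ^ k * ‖z‖) ^ (-σ)

variable {σ : ℝ} {k : ℕ} {h : RD d → ℂ}

lemma rpow_neg_le_one (hσ : 0 ≤ σ) (k : ℕ) (z : RD d) :
    (1 + (2 : ℝ) ^ k * ‖z‖) ^ (-σ) ≤ 1 :=
  Real.rpow_le_one_of_one_le_of_nonpos (by have : 0 ≤ (2 : ℝ) ^ k * ‖z‖ := by positivity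
                                           linarith) (by linarith)

lemma bddAbove_peetreFun (hσ : 0 ≤ σ) {B : ℝ} (hB : ∀ x, ‖h x‖ ≤ B) (x : RD d) :
    BddAbove (Set.range fun z : RD d => ‖h (x - z)‖ * (1 + (2 : ℝ) ^ k * ‖z‖) ^ (-σ)) := by
  refine ⟨B, ?_⟩
  rintro _ ⟨z, rfl⟩
  exact (mul_le_of_le_one_right (norm_nonneg _) (rpow_neg_le_one hσ k z)).trans (hB _)

lemma peetreFun_nonneg (x : RD d) : 0 ≤ peetreFun σ k h x :=
  Real.iSup_nonneg fun z => by positivity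

lemma peetreFun_le (hσ : 0 ≤ σ) {B : ℝ} (hB : ∀ x, ‖h x‖ ≤ B) (x : RD d) :
    peetreFun σ k h x ≤ B :=
  ciSup_le fun z => (mul_le_of_le_one_right (norm_nonneg _) (rpow_neg_le_one hσ k z)).trans (hB _)

lemma norm_le_peetreFun_mul (hσ : 0 ≤ σ) {B : ℝ} (hB : ∀ x, ‖h x‖ ≤ B) (x z : RD d) :
    ‖h (x - z)‖ ≤ peetreFun σ k h x * (1 + (2 : ℝ) ^ k * ‖z‖) ^ σ := by
  have h1 : ‖h (x - z)‖ * (1 + (2 : ℝ) ^ k * ‖z‖) ^ (-σ) ≤ peetreFun σ k h x :=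
    le_ciSup (bddAbove_peetreFun hσ hB x) z
  rwa [Real.rpow_neg (by positivity), ← div_eq_mul_inv, div_le_iff₀ (by positivity)] at h1

lemma peetreFun_sub_le (hσ : 0 ≤ σ) {B : ℝ} (hB : ∀ x, ‖h x‖ ≤ B) (x y : RD d) :
    peetreFun σ k h (x - y) ≤ peetreFun σ k h x * (1 + (2 : ℝ) ^ k * ‖y‖) ^ σ := by
  refine ciSup_le fun z => ?_
  have h1 := norm_le_peetreFun_mul (k := k) hσ hB x (y + z)
  rw [← sub_sub] at h1
  rw [Real.rpow_neg (by positivity), ← div_eq_mul_inv, div_le_iff₀ (by positivity)]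
  refine h1.trans ?_
  rw [mul_assoc, ← Real.mul_rpow (by positivity) (by positivity)]
  have := peetreFun_nonneg (σ := σ) (k := k) (h := h) x
  gcongr
  exact one_add_mul_norm_le k y z

/-- An operator whose kernel decays at scale `2^{-k}` is bounded by the maximal function. -/
lemma norm_integral_kernel_le (hσ : 0 ≤ σ) {B : ℝ} (hB : ∀ x, ‖h x‖ ≤ B) {N : ℝ}
    (hN : d < N - σ) {A : ℝ} {K : RD d → ℂ} (hK : ∀ z, ‖K z‖ ≤ A * wt d N k z)
    (x : RD d) :
    ‖∫ y, h y * K (x - y)‖ ≤ A * wtMass d (N - σ) * peetreFun σ k h x := by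
  rw [← integral_sub_left_eq_self _ volume x]
  simp only [sub_sub_cancel]
  rw [← integral_wt (d := d) (N - σ) k, ← integral_const_mul, ← integral_mul_const]
  refine norm_integral_le_of_norm_le (((integrable_wt hN k).const_mul A).mul_const _)
    (Eventually.of_forall fun z => ?_)
  rw [norm_mul]
  have h0 := peetreFun_nonneg (σ := σ) (k := k) (h := h) x
  calc ‖h (x - z)‖ * ‖K z‖
      ≤ (peetreFun σ k h x * (1 + (2 : ℝ) ^ k * ‖z‖) ^ σ) * (A * wt d N k z) :=
        mul_le_mul (norm_le_peetreFun_mul hσ hB x z) (hK z) (norm_nonneg _) (by positivity)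
    _ = A * (wt d N k z * (1 + (2 : ℝ) ^ k * ‖z‖) ^ σ) * peetreFun σ k h x := by ring
    _ = _ := by rw [wt_mul_rpow]

lemma integrable_norm_mul_rpow (σ : ℝ) (ψ : 𝓢(RD d, ℂ)) :
    Integrable (fun y => ‖ψ y‖ * (1 + 8 * ‖y‖) ^ σ) := by
  obtain ⟨n, hn⟩ := exists_nat_ge σ
  have h1 := (ψ.integrable_pow_mul volume n).const_mul ((2 * 8 : ℝ) ^ n)
  have h2 := (ψ.integrable (μ := volume)).norm.const_mul ((2 : ℝ) ^ n)
  refine (h2.add h1).mono' ?_ (Eventually.of_forall fun y => ?_)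
  · refine Continuous.aestronglyMeasurable ?_
    exact ψ.continuous.norm.mul
      (Continuous.rpow_const (by fun_prop) fun z => Or.inl (by positivity))
  · have : (1 + 8 * ‖y‖) ^ σ ≤ 2 ^ n + (2 * 8) ^ n * ‖y‖ ^ n := by
      calc (1 + 8 * ‖y‖) ^ σ ≤ (1 + 8 * ‖y‖) ^ (n : ℝ) :=
            Real.rpow_le_rpow_of_exponent_le (by have := norm_nonneg y; linarith) hn
        _ = (1 + 8 * ‖y‖) ^ n := Real.rpow_natCast _ _
        _ ≤ _ := by
          rw [← mul_pow]
          rcases le_total (8 * ‖y‖) 1 with h | h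
          · calc (1 + 8 * ‖y‖) ^ n ≤ 2 ^ n := by gcongr; linarith
              _ ≤ _ := le_add_of_nonneg_right (by positivity)
          · calc (1 + 8 * ‖y‖) ^ n ≤ (2 * 8 * ‖y‖) ^ n := by gcongr; linarith
              _ ≤ _ := le_add_of_nonneg_left (by positivity)
    rw [Real.norm_of_nonneg (by positivity)]
    calc ‖ψ y‖ * (1 + 8 * ‖y‖) ^ σ ≤ ‖ψ y‖ * (2 ^ n + (2 * 8) ^ n * ‖y‖ ^ n) := by gcongr
      _ = _ := by simp only [Pi.add_apply]; ring

lemma exists_norm_LP_le_peetreFun (D : LPData d) (hσ : 0 ≤ σ) :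
    ∃ C : ℝ, 0 ≤ C ∧ ∀ (k l : ℕ) (h : RD d → ℂ) (B A : ℝ) (g : RD d → ℂ),
      (∀ x, ‖h x‖ ≤ B) → k ≤ l + 3 → 0 ≤ A → (∀ x, ‖g x‖ ≤ A * peetreFun σ k h x) →
      ∀ x, ‖LP D l g x‖ ≤ C * A * peetreFun σ k h x := by
  let I : ℕ → ℝ := fun l => ∫ y, ‖lpProfile D l y‖ * (1 + 8 * ‖y‖) ^ σ
  have hI0 : ∀ l, 0 ≤ I l := fun l => integral_nonneg fun y => by positivity
  have hI : ∀ l, I l ≤ I 0 + I 1 := by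
    intro l
    cases l with
    | zero => linarith [hI0 1]
    | succ l => exact le_add_of_nonneg_left (hI0 0)
  refine ⟨I 0 + I 1, add_nonneg (hI0 0) (hI0 1), fun k l h B A g hB hkl hA hg x => ?_⟩
  have h0 := peetreFun_nonneg (σ := σ) (k := k) (h := h) x
  rw [LP_eq_integral, lpKer, integral_dil_mul _ _ (fun y => g (x - y))]
  refine le_trans ?_ (mul_le_mul_of_nonneg_right (mul_le_mul_of_nonneg_right (hI l) hA) h0)
  rw [← integral_mul_const, ← integral_mul_const]
  refine norm_integral_le_of_norm_le (((integrable_norm_mul_rpow σ _).mul_const _).mul_const _)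
    (Eventually.of_forall fun y => ?_)
  rw [norm_mul]
  have h1 : (1 + (2 : ℝ) ^ k * ‖((2 : ℝ) ^ l)⁻¹ • y‖) ^ σ ≤ (1 + 8 * ‖y‖) ^ σ := by
    refine Real.rpow_le_rpow (by positivity) (add_le_add_right ?_ 1) hσ
    rw [norm_smul, norm_inv, Real.norm_of_nonneg (by positivity), ← mul_assoc]
    gcongr
    rw [mul_inv_le_iff₀ (by positivity)]
    calc (2 : ℝ) ^ k ≤ 2 ^ (l + 3) := pow_le_pow_right₀ (by norm_num) hkl
      _ = _ := by ring
  calc ‖lpProfile D l y‖ * ‖g (x - ((2 : ℝ) ^ l)⁻¹ • y)‖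
      ≤ ‖lpProfile D l y‖ * (A * (peetreFun σ k h x * (1 + 8 * ‖y‖) ^ σ)) := by
        gcongr
        refine (hg _).trans ?_
        gcongr
        exact (peetreFun_sub_le hσ hB x _).trans (by gcongr)
    _ = _ := by ring

/-- The maximal function of a frequency-localised function is controlled by local `L^q` means. -/
lemma exists_peetreFun_rpow_le (D : LPData d) {q L : ℝ} (hq : 0 < q) (hL : d < L)
    (hσ1 : L ≤ σ) (hσ2 : L ≤ σ * q) :
    ∃ C : ℝ, 0 ≤ C ∧ ∀ (k : ℕ) (f h : 𝓢(RD d, ℂ)),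
      (∀ ξ, fourierS h ξ = LPhat D k ξ * fourierS f ξ) → ∀ x,
      peetreFun σ k h x ^ q ≤ C * ∫ y, wt d L k y * ‖h (x - y)‖ ^ q := by
  have hσ : 0 ≤ σ := le_trans (by positivity) (hL.le.trans hσ1)
  obtain ⟨N, hN⟩ := exists_nat_ge σ
  obtain ⟨C, hC0, hC⟩ := exists_norm_cutKer_le (isSymbolS11_one (d := d)) N
  have hI := wtMass_nonneg (d := d) L
  let c : ℝ := 2 * C * wtMass d L + 1
  have hc : 0 < c := by positivity
  refine ⟨2 * C * (c ^ (q - 1) + 1), by positivity, fun k f h hf x => ?_⟩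
  have hB : ∀ x, ‖h x‖ ≤ SchwartzMap.seminorm ℝ 0 0 h := h.norm_le_seminorm ℝ
  set G := peetreFun σ k h x with hG
  have hG0 : 0 ≤ G := peetreFun_nonneg x
  have hwi : Integrable (wt d L k) := integrable_wt hL k
  have h_int : Integrable (fun y => wt d L k y * ‖h (x - y)‖ ^ q) := by
    refine hwi.mul_bdd (c := (SchwartzMap.seminorm ℝ 0 0 h) ^ q) ?_
      (Eventually.of_forall fun y => ?_)
    · refine Continuous.aestronglyMeasurable (Continuous.rpow_const ?_ fun y => Or.inr hq.le)
      exact (h.continuous.comp (by fun_prop : Continuous fun y : RD d => x - y)).norm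
    · rw [Real.norm_of_nonneg (by positivity)]
      exact Real.rpow_le_rpow (norm_nonneg _) (hB _) hq.le
  set A := ∫ y, wt d L k y * ‖h (x - y)‖ ^ q with hA
  have hA0 : 0 ≤ A := integral_nonneg fun y => mul_nonneg (wt_nonneg _ _ _) (by positivity)
  rcases hG0.eq_or_lt with hz | hpos
  · rw [← hz, Real.zero_rpow hq.ne']
    positivity
  -- the pointwise consequence of the reproducing formula
  have hrep : ∀ E : RD d → ℝ, Integrable E →
      (∀ y, wt d σ k y * ‖h (x - y)‖ ≤ E y) → G ≤ C * ∫ y, E y := by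
    intro E hE hle
    refine ciSup_le fun z => ?_
    have h1 : ‖h (x - z)‖ * (1 + (2 : ℝ) ^ k * ‖z‖) ^ (-σ) =
        ‖∫ y, (((1 + (2 : ℝ) ^ k * ‖z‖) ^ (-σ) : ℝ) : ℂ) *
          (h (x - y) * cutKer (fun _ _ => 1) k (x - z) (y - z))‖ := by
      rw [integral_const_mul, norm_mul, Complex.norm_real, Real.norm_of_nonneg (by positivity),
        mul_comm, eq_integral_cutKer_one D k hf (x - z)]
      congr 2
      rw [← integral_sub_left_eq_self _ volume x]
      congr 1 with y
      congr 2
      abel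
    rw [h1, ← integral_const_mul]
    refine norm_integral_le_of_norm_le (hE.const_mul C) (Eventually.of_forall fun y => ?_)
    rw [norm_mul, norm_mul, Complex.norm_real, Real.norm_of_nonneg (by positivity)]
    have h2 : (1 + (2 : ℝ) ^ k * ‖z‖) ^ (-σ) * wt d N k (y - z) ≤ wt d σ k y := by
      refine (mul_le_mul_of_nonneg_left (wt_anti hN k _) (by positivity)).trans ?_
      rw [wt, wt, mul_left_comm, ← Real.mul_rpow (by positivity) (by positivity)]
      refine mul_le_mul_of_nonneg_left ?_ (by positivity)
      refine Real.rpow_le_rpow_of_nonpos (by positivity) ?_ (by linarith)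
      have := one_add_mul_norm_le k z (y - z)
      rwa [add_sub_cancel] at this
    have h3 := hC k (x - z) (y - z)
    simp only [Real.rpow_zero, mul_one] at h3
    calc _ ≤ (1 + (2 : ℝ) ^ k * ‖z‖) ^ (-σ) * (‖h (x - y)‖ * (C * wt d N k (y - z))) := by gcongr
      _ = C * (((1 + (2 : ℝ) ^ k * ‖z‖) ^ (-σ) * wt d N k (y - z)) * ‖h (x - y)‖) := by ring
      _ ≤ C * (wt d σ k y * ‖h (x - y)‖) := by gcongr
      _ ≤ _ := by gcongr; exact hle y
  suffices hmain : G ≤ 2 * C * (c ^ (q - 1) + 1) * (G ^ (1 - q) * A) by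
    have h1 : G ^ q = G / G ^ (1 - q) := by
      rw [Real.rpow_sub hpos, Real.rpow_one]
      field_simp
    rw [h1, div_le_iff₀ (by positivity)]
    calc G ≤ _ := hmain
      _ = _ := by ring
  have hGA : 0 ≤ G ^ (1 - q) * A := by positivity
  rcases le_total q 1 with hq1 | hq1
  · have := hrep (fun y => G ^ (1 - q) * (wt d L k y * ‖h (x - y)‖ ^ q)) (h_int.const_mul _) ?_
    · rw [integral_const_mul] at this
      refine this.trans ?_
      have hcp : 0 ≤ c ^ (q - 1) := by positivity
      have : C * (G ^ (1 - q) * A) ≤ 2 * (c ^ (q - 1) + 1) * (C * (G ^ (1 - q) * A)) :=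
        le_mul_of_one_le_left (by positivity) (by linarith)
      linarith
    · intro y
      have hy := norm_le_peetreFun_mul (k := k) hσ hB x y
      rw [← hG] at hy
      have e : ‖h (x - y)‖ = ‖h (x - y)‖ ^ (1 - q) * ‖h (x - y)‖ ^ q := by
        rcases (norm_nonneg (h (x - y))).eq_or_lt with h0 | h0
        · rw [← h0, Real.zero_rpow hq.ne', mul_zero]
        · rw [← Real.rpow_add h0]
          simp
      have h1 : ‖h (x - y)‖ ^ (1 - q) ≤
          G ^ (1 - q) * (1 + (2 : ℝ) ^ k * ‖y‖) ^ (σ * (1 - q)) := by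
        rw [Real.rpow_mul (by positivity), ← Real.mul_rpow hG0 (by positivity)]
        exact Real.rpow_le_rpow (norm_nonneg _) hy (by linarith)
      calc wt d σ k y * ‖h (x - y)‖
          = wt d σ k y * (‖h (x - y)‖ ^ (1 - q) * ‖h (x - y)‖ ^ q) := by rw [← e]
        _ ≤ wt d σ k y * (G ^ (1 - q) * (1 + (2 : ℝ) ^ k * ‖y‖) ^ (σ * (1 - q)) *
              ‖h (x - y)‖ ^ q) := by
            have := wt_nonneg (d := d) σ k y
            gcongr
        _ = G ^ (1 - q) * (wt d σ k y * (1 + (2 : ℝ) ^ k * ‖y‖) ^ (σ * (1 - q)) *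
              ‖h (x - y)‖ ^ q) := by ring
        _ ≤ _ := by
            rw [wt_mul_rpow]
            gcongr
            exact wt_anti (by linarith) k y
  · have hlam : 0 < G / c := by positivity
    have := hrep (fun y => (G / c) ^ (1 - q) * (wt d L k y * ‖h (x - y)‖ ^ q) +
      (G / c) * wt d L k y) ((h_int.const_mul _).add (hwi.const_mul _)) ?_
    · rw [integral_add (h_int.const_mul _) (hwi.const_mul _), integral_const_mul,
        integral_const_mul, integral_wt, Real.div_rpow hG0 hc.le] at this
      have h1 : C * (G / c * wtMass d L) ≤ G / 2 := by
        rw [div_mul_eq_mul_div, mul_div_assoc', div_le_div_iff₀ hc (by norm_num)]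
        simp only [c]
        nlinarith
      have h2 : c ^ (q - 1) = (c ^ (1 - q))⁻¹ := by
        rw [← Real.rpow_neg hc.le]
        ring_nf
      have h3 : 0 ≤ C * (G ^ (1 - q) * A) := by positivity
      have h4 : G ^ (1 - q) / c ^ (1 - q) * A = c ^ (q - 1) * (G ^ (1 - q) * A) := by
        rw [h2]
        ring
      rw [h4, mul_add] at this
      nlinarith
    · intro y
      have hw := wt_nonneg (d := d) L k y
      refine (mul_le_mul_of_nonneg_right (wt_anti hσ1 k y) (norm_nonneg _)).trans ?_
      rw [show (G / c) ^ (1 - q) * (wt d L k y * ‖h (x - y)‖ ^ q) + (G / c) * wt d L k y =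
        wt d L k y * ((G / c) ^ (1 - q) * ‖h (x - y)‖ ^ q + G / c) by ring]
      gcongr
      rcases le_total ‖h (x - y)‖ (G / c) with hle | hle
      · exact hle.trans (le_add_of_nonneg_left (by positivity))
      · have hh : 0 < ‖h (x - y)‖ := hlam.trans_le hle
        calc ‖h (x - y)‖ = ‖h (x - y)‖ ^ (1 - q) * ‖h (x - y)‖ ^ q := by
              rw [← Real.rpow_add hh]
              simp
          _ ≤ (G / c) ^ (1 - q) * ‖h (x - y)‖ ^ q := by
              exact mul_le_mul_of_nonneg_right
                (Real.rpow_le_rpow_of_nonpos hlam hle (by linarith)) (by positivity)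
          _ ≤ _ := le_add_of_nonneg_right hlam.le

end FarPart

namespace FarPart

variable {d : ℕ} {m : ℝ} {a : RD d → RD d → ℂ}

/-! ### The pieces of the operator and their frequency supports -/

lemma integrable_one_add_norm_rpow_mul (g : 𝓢(RD d, ℂ)) (r : ℝ) :
    Integrable (fun ξ => (1 + ‖ξ‖) ^ r * ‖g ξ‖) := by
  refine (integrable_norm_mul_rpow (max r 0) g).mono' ?_
    (Eventually.of_forall fun ξ => ?_)
  · refine Continuous.aestronglyMeasurable (Continuous.mul ?_ g.continuous.norm)
    exact Continuous.rpow_const (by fun_prop) fun z => Or.inl (by positivity)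
  · rw [Real.norm_of_nonneg (by positivity), mul_comm]
    gcongr
    have h0 := norm_nonneg ξ
    calc (1 + ‖ξ‖) ^ r ≤ (1 + ‖ξ‖) ^ max r 0 :=
          Real.rpow_le_rpow_of_exponent_le (by linarith) (le_max_left _ _)
      _ ≤ _ := Real.rpow_le_rpow (by positivity) (by linarith) (le_max_right _ _)

lemma symConv_lpProfile (D : LPData d) (a : RD d → RD d → ℂ) (j : ℕ) (x ξ : RD d) :
    symConv (lpProfile D j) a (2 ^ j) x ξ = symConv (lpKer D j) a 1 x ξ := by
  rw [symConv_eq_integral_dil]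
  simp [symConv, lpKer]

lemma exists_norm_symConv_lpProfile_le (D : LPData d) (ha : IsSymbolS11 d m a) :
    ∃ C : ℝ, 0 ≤ C ∧ ∀ j x ξ, ‖symConv (lpProfile D j) a (2 ^ j) x ξ‖ ≤
      C * (((2 : ℝ) ^ j)⁻¹ * (1 + ‖ξ‖) ^ (m + 1)) := by
  obtain ⟨C₀, h0, hC₀⟩ := exists_norm_symConv_le D.Φ ha
  obtain ⟨C₁, h1, hC₁⟩ := (annulusSupported_φ D).exists_norm_symConv_le 1 ha
  refine ⟨C₀ + C₁, by positivity, fun j x ξ => ?_⟩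
  cases j with
  | zero =>
    refine (hC₀ _ x ξ).trans ?_
    simp only [pow_zero, inv_one, one_mul]
    have h0 := norm_nonneg ξ
    gcongr
    · linarith
    · linarith
    · linarith
  | succ j =>
    refine (hC₁ (2 ^ (j + 1)) (by positivity) x ξ).trans ?_
    simp only [pow_one, Nat.cast_one]
    gcongr
    linarith

lemma exists_norm_LPhat_le (D : LPData d) :
    ∃ C : ℝ, 0 ≤ C ∧ ∀ k ξ, ‖LPhat D k ξ‖ ≤ C * (((2 : ℝ) ^ k)⁻¹ * (1 + ‖ξ‖)) := by
  have hΦ := (fourierS D.Φ).norm_le_seminorm ℝ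
  have hφ := (fourierS D.φ).norm_le_seminorm ℝ
  set A := SchwartzMap.seminorm ℝ 0 0 (fourierS D.Φ)
  set B := SchwartzMap.seminorm ℝ 0 0 (fourierS D.φ)
  have hA : 0 ≤ A := (norm_nonneg _).trans (hΦ 0)
  have hB : 0 ≤ B := (norm_nonneg _).trans (hφ 0)
  refine ⟨A + 2 * B, by positivity, fun k ξ => ?_⟩
  have h0 := norm_nonneg ξ
  cases k with
  | zero =>
    simp only [LPhat, pow_zero, inv_one, one_mul]
    nlinarith [hΦ ξ]
  | succ k =>
    by_cases h : LPhat D (k + 1) ξ = 0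
    · rw [h, norm_zero]
      positivity
    · have h1 := le_norm_of_LPhat_ne_zero D (by omega) h
      have h2 : 1 / 2 ≤ ((2 : ℝ) ^ (k + 1))⁻¹ * (1 + ‖ξ‖) := by
        rw [le_inv_mul_iff₀ (by positivity)]
        linarith
      have h3 : ‖LPhat D (k + 1) ξ‖ ≤ B := hφ _
      nlinarith

/-- The integrand defining `T_{a_{j,k}} f`. -/
lemma pdo_symbolPiece (D : LPData d) (a : RD d → RD d → ℂ) (j k : ℕ) (f : 𝓢(RD d, ℂ)) (x : RD d) :
    pdo (symbolPiece D a j k) f x =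
      ∫ ξ, symConv (lpProfile D j) a (2 ^ j) x ξ * LPhat D k ξ * fourierS f ξ * osc x ξ := by
  simp only [pdo, symbolPiece_eq, osc]

lemma continuous_LPhat (D : LPData d) (k : ℕ) : Continuous (LPhat D k) := by
  rw [show LPhat D k = fourierS (lpKer D k) from funext fun ξ => (fourierS_lpKer D k ξ).symm]
  exact (fourierS (lpKer D k)).continuous

lemma stronglyMeasurable_piece_integrand (D : LPData d) (ha : IsSymbolS11 d m a) (j k : ℕ)
    (f : 𝓢(RD d, ℂ)) : StronglyMeasurable (fun p : RD d × RD d =>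
      symConv (lpProfile D j) a (2 ^ j) p.1 p.2 * LPhat D k p.2 * fourierS f p.2 *
        osc p.1 p.2) := by
  have h1 := ((continuous_LPhat D k).comp (continuous_snd (X := RD d))).stronglyMeasurable
  have h2 := ((fourierS f).continuous.comp (continuous_snd (X := RD d))).stronglyMeasurable
  exact (((stronglyMeasurable_symConv _ ha _).mul h1).mul h2).mul
    continuous_osc.stronglyMeasurable

lemma exists_piece_integrand_le (D : LPData d) (ha : IsSymbolS11 d m a) (f : 𝓢(RD d, ℂ)) :
    ∃ g : RD d → ℝ, Integrable g ∧ (∀ ξ, 0 ≤ g ξ) ∧ ∀ j k x ξ,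
      ‖symConv (lpProfile D j) a (2 ^ j) x ξ * LPhat D k ξ * fourierS f ξ * osc x ξ‖ ≤
        ((2 : ℝ) ^ j)⁻¹ * ((2 : ℝ) ^ k)⁻¹ * g ξ := by
  obtain ⟨C₁, h1, hC₁⟩ := exists_norm_symConv_lpProfile_le D ha
  obtain ⟨C₂, h2, hC₂⟩ := exists_norm_LPhat_le D
  refine ⟨fun ξ => C₁ * C₂ * ((1 + ‖ξ‖) ^ (m + 2) * ‖fourierS f ξ‖),
    (integrable_one_add_norm_rpow_mul _ _).const_mul _, fun ξ => by positivity, fun j k x ξ => ?_⟩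
  rw [norm_mul, norm_mul, norm_mul, norm_osc, mul_one]
  calc _ ≤ C₁ * (((2 : ℝ) ^ j)⁻¹ * (1 + ‖ξ‖) ^ (m + 1)) *
        (C₂ * (((2 : ℝ) ^ k)⁻¹ * (1 + ‖ξ‖))) * ‖fourierS f ξ‖ := by
        gcongr
        · exact hC₁ j x ξ
        · exact hC₂ k ξ
    _ = _ := by
        beta_reduce
        rw [show m + 2 = m + 1 + 1 by ring, Real.rpow_add_one (by positivity) (m + 1)]
        ring

lemma exists_norm_piece_le (D : LPData d) (ha : IsSymbolS11 d m a) (f : 𝓢(RD d, ℂ)) :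
    ∃ C : ℝ, 0 ≤ C ∧ ∀ j k x, ‖pdo (symbolPiece D a j k) f x‖ ≤
      C * (((2 : ℝ) ^ j)⁻¹ * ((2 : ℝ) ^ k)⁻¹) := by
  obtain ⟨g, hg, hg0, hle⟩ := exists_piece_integrand_le D ha f
  refine ⟨∫ ξ, g ξ, integral_nonneg hg0, fun j k x => ?_⟩
  rw [pdo_symbolPiece, mul_comm (∫ ξ, g ξ), ← integral_const_mul]
  exact norm_integral_le_of_norm_le (hg.const_mul _) (Eventually.of_forall fun ξ => hle j k x ξ)

lemma stronglyMeasurable_piece (D : LPData d) (ha : IsSymbolS11 d m a) (j k : ℕ)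
    (f : 𝓢(RD d, ℂ)) : StronglyMeasurable (pdo (symbolPiece D a j k) f) := by
  rw [show pdo (symbolPiece D a j k) f = fun x => _ from
    funext fun x => pdo_symbolPiece D a j k f x]
  exact (stronglyMeasurable_piece_integrand D ha j k f).integral_prod_right

lemma integrable_lpKer_mul (D : LPData d) (l : ℕ) {g : RD d → ℂ} {B : ℝ}
    (hg : StronglyMeasurable g) (hB : ∀ x, ‖g x‖ ≤ B) (x : RD d) :
    Integrable (fun y => lpKer D l y * g (x - y)) :=
  (lpKer D l).integrable.mul_bdd (c := B)
    (hg.comp_measurable (measurable_const.sub measurable_id)).aestronglyMeasurable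
    (Eventually.of_forall fun _ => hB _)

lemma LP_sum (D : LPData d) (ha : IsSymbolS11 d m a) (l k : ℕ) (f : 𝓢(RD d, ℂ)) (s : Finset ℕ)
    (x : RD d) :
    ∑ j ∈ s, LP D l (pdo (symbolPiece D a j k) f) x =
      LP D l (fun x => ∑ j ∈ s, pdo (symbolPiece D a j k) f x) x := by
  obtain ⟨C, -, hC⟩ := exists_norm_piece_le D ha f
  simp only [LP_eq_integral, Finset.mul_sum]
  rw [integral_finsetSum]
  exact fun j _ => integrable_lpKer_mul D l (stronglyMeasurable_piece D ha j k f)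
    (fun x => hC j k x) x

lemma LP_Sfar (D : LPData d) (ha : IsSymbolS11 d m a) (f : 𝓢(RD d, ℂ)) (l : ℕ) (x : RD d) :
    LP D l (Sfar D a f) x = ∑' p : ℕ × ℕ, if 3 ≤ |(p.1 : ℤ) - (p.2 : ℤ)| then
      LP D l (pdo (symbolPiece D a p.1 p.2) f) x else 0 := by
  obtain ⟨C, hC0, hC⟩ := exists_norm_piece_le D ha f
  let F : ℕ × ℕ → RD d → ℂ := fun p y => if 3 ≤ |(p.1 : ℤ) - (p.2 : ℤ)| then
    pdo (symbolPiece D a p.1 p.2) f y else 0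
  have hF : ∀ p y, ‖F p y‖ ≤ C * (((2 : ℝ) ^ p.1)⁻¹ * ((2 : ℝ) ^ p.2)⁻¹) := by
    intro p y
    simp only [F]
    split_ifs
    · exact hC _ _ _
    · rw [norm_zero]
      positivity
  have hFm : ∀ p, StronglyMeasurable (F p) := by
    intro p
    simp only [F]
    split_ifs
    · exact stronglyMeasurable_piece D ha _ _ f
    · exact stronglyMeasurable_const
  have hsum : Summable (fun p : ℕ × ℕ => C * (((2 : ℝ) ^ p.1)⁻¹ * ((2 : ℝ) ^ p.2)⁻¹)) := by
    have hg : Summable (fun n : ℕ => ((2 : ℝ) ^ n)⁻¹) := by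
      simpa using summable_geometric_two
    exact (hg.mul_of_nonneg hg (fun n => by positivity) (fun n => by positivity)).mul_left C
  have hi : ∀ p, Integrable (fun y => lpKer D l y * F p (x - y)) := fun p =>
    integrable_lpKer_mul D l (hFm p) (hF p) x
  have key := integral_tsum_of_summable_integral_norm (μ := volume) hi (by
    refine Summable.of_nonneg_of_le (fun p => integral_nonneg fun y => norm_nonneg _)
      (fun p => ?_) (hsum.mul_left (∫ y, ‖lpKer D l y‖))
    rw [← integral_mul_const]
    refine integral_mono (hi p).norm ((lpKer D l).integrable.norm.mul_const _) fun y => ?_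
    simp only [norm_mul]
    gcongr
    exact hF p _)
  rw [LP_eq_integral]
  calc _ = ∫ y, ∑' p, lpKer D l y * F p (x - y) := by
        congr 1 with y
        rw [tsum_mul_left]
        rfl
    _ = ∑' p, ∫ y, lpKer D l y * F p (x - y) := key.symm
    _ = _ := by
        congr 1 with p
        simp only [F]
        split_ifs
        · rw [LP_eq_integral]
        · simp

/-! ### Frequency localisation -/

lemma integral_mul_osc_mul (ψ χ : 𝓢(RD d, ℂ)) (ξ v : RD d) :
    ∫ y, ψ y * osc (-y) ξ * χ (v - y) =
      ∫ η, fourierS χ η * osc v η * fourierS ψ (ξ + η) := by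
  have e : ∀ y η, osc (v - y) η = osc v η * osc (-y) η := fun y η => by
    rw [← osc_add, sub_eq_add_neg]
  have e2 : ∀ y η, osc (-y) (ξ + η) = osc (-y) ξ * osc (-y) η := fun y η => by
    simp only [osc, ← Complex.exp_add, inner_add_right]
    push_cast
    ring_nf
  have e3 : ∀ y, χ (v - y) = ∫ η, fourierS χ η * (osc v η * osc (-y) η) := fun y => by
    rw [eq_integral_fourierS χ (v - y)]
    simp only [e]
  simp only [e3, fourierS_eq_integral ψ, ← integral_const_mul, e2]
  rw [integral_integral_swap]
  · congr 1 with η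
    congr 1 with y
    ring
  · refine ((ψ.integrable (μ := volume)).mul_prod
      ((fourierS χ).integrable (μ := volume))).norm.mono' ?_ (Eventually.of_forall fun p => ?_)
    · have h1 := ψ.continuous.comp (continuous_fst (Y := RD d))
      have h2 := (fourierS χ).continuous.comp (continuous_snd (X := RD d))
      have h3 := continuous_osc.comp (by fun_prop : Continuous fun p : RD d × RD d => (-p.1, ξ))
      have h4 := continuous_osc.comp (by fun_prop : Continuous fun p : RD d × RD d => (v, p.2))
      have h5 := continuous_osc.comp (by fun_prop : Continuous fun p : RD d × RD d => (-p.1, p.2))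
      exact ((h1.mul h3).mul (h2.mul (h4.mul h5))).aestronglyMeasurable
    · simp only [Function.uncurry, norm_mul, norm_osc, mul_one]
      exact le_rfl

lemma integral_mul_osc_mul_symConv_eq_zero (ψ χ : 𝓢(RD d, ℂ)) (ha : IsSymbolS11 d m a)
    (x ξ : RD d) (hz : ∀ η, fourierS χ η ≠ 0 → fourierS ψ (ξ + η) = 0) :
    ∫ y, ψ y * osc (-y) ξ * symConv χ a 1 (x - y) ξ = 0 := by
  obtain ⟨c, -, hc⟩ := ha.exists_norm_le
  have h1 : ∀ y, symConv χ a 1 (x - y) ξ = ∫ v, χ (v - y) * a (x - v) ξ := by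
    intro y
    rw [symConv, ← integral_sub_right_eq_self _ y]
    congr 1 with v
    simp
  simp only [h1, ← integral_const_mul]
  rw [integral_integral_swap]
  · have h2 : ∀ v, ∫ y, ψ y * osc (-y) ξ * (χ (v - y) * a (x - v) ξ) = 0 := by
      intro v
      simp only [← mul_assoc]
      rw [integral_mul_const, integral_mul_osc_mul]
      rw [integral_eq_zero_of_ae, zero_mul]
      refine Eventually.of_forall fun η => ?_
      by_cases h : fourierS χ η = 0
      · simp [h]
      · simp [hz η h]
    simp [h2]
  · have hi := (((ψ.integrable (μ := volume)).convolution_integrand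
      (ContinuousLinearMap.mul ℂ ℂ) (χ.integrable (μ := volume))).swap.norm).mul_const
        (c * (1 + ‖ξ‖) ^ m)
    refine hi.mono' ?_ (Eventually.of_forall fun p => ?_)
    · have h1 := ψ.continuous.comp (continuous_fst (Y := RD d))
      have h2 := χ.continuous.comp (by fun_prop : Continuous fun p : RD d × RD d => p.2 - p.1)
      have h3 := continuous_osc.comp (by fun_prop : Continuous fun p : RD d × RD d => (-p.1, ξ))
      have h4 := ha.continuous.comp (by fun_prop : Continuous fun p : RD d × RD d => (x - p.2, ξ))
      exact ((h1.mul h3).mul (h2.mul h4)).aestronglyMeasurable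
    · simp only [Function.uncurry, norm_mul, norm_osc, mul_one, Function.comp, Prod.fst_swap,
        Prod.snd_swap, ContinuousLinearMap.mul_apply']
      rw [← mul_assoc]
      gcongr
      exact hc _ _

lemma LP_piece_eq_zero (D : LPData d) (ha : IsSymbolS11 d m a) (f : 𝓢(RD d, ℂ)) {j k l : ℕ}
    (hz : ∀ ξ η, LPhat D k ξ ≠ 0 → LPhat D j η ≠ 0 → LPhat D l (ξ + η) = 0) (x : RD d) :
    LP D l (pdo (symbolPiece D a j k) f) x = 0 := by
  obtain ⟨g, hg, hg0, hle⟩ := exists_piece_integrand_le D ha f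
  rw [LP_eq_integral]
  simp only [pdo_symbolPiece, ← integral_const_mul]
  rw [integral_integral_swap]
  · refine integral_eq_zero_of_ae (Eventually.of_forall fun ξ => ?_)
    by_cases h : LPhat D k ξ = 0
    · simp [h]
    · have h0 := integral_mul_osc_mul_symConv_eq_zero (lpKer D l) (lpKer D j) ha x ξ (fun η hη => by
        rw [fourierS_lpKer] at hη ⊢
        exact hz ξ η h hη)
      calc _ = ∫ y, (LPhat D k ξ * fourierS f ξ * osc x ξ) * (lpKer D l y * osc (-y) ξ *
            symConv (lpKer D j) a 1 (x - y) ξ) := by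
            refine integral_congr_ae (Eventually.of_forall fun y => ?_)
            beta_reduce
            rw [symConv_lpProfile, sub_eq_add_neg, osc_add]
            ring
        _ = 0 := by rw [integral_const_mul, h0, mul_zero]
  · refine (((lpKer D l).integrable (μ := volume)).norm.mul_prod (hg.const_mul
      (((2 : ℝ) ^ j)⁻¹ * ((2 : ℝ) ^ k)⁻¹))).mono' ?_ (Eventually.of_forall fun p => ?_)
    · refine (((lpKer D l).continuous.comp (continuous_fst (Y := RD d))).stronglyMeasurable.mul
        ((stronglyMeasurable_piece_integrand D ha j k f).comp_measurable
          (g := fun p : RD d × RD d => (x - p.1, p.2)) (by fun_prop))).aestronglyMeasurable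
    · simp only [Function.uncurry, norm_mul (lpKer D l p.1)]
      gcongr
      exact hle j k _ _

lemma add_three_of_two_pow_le {k l : ℕ} (h : (2 : ℝ) ^ k < 16 * 2 ^ l) : k ≤ l + 3 := by
  by_contra! h'
  have : (2 : ℝ) ^ (l + 4) ≤ 2 ^ k := pow_le_pow_right₀ (by norm_num) (by omega)
  rw [pow_add] at this
  linarith

lemma LPhat_add_ne_zero (D : LPData d) {j k l : ℕ} (hjk : j + 3 ≤ k) {ξ η : RD d}
    (hξ : LPhat D k ξ ≠ 0) (hη : LPhat D j η ≠ 0) (h : LPhat D l (ξ + η) ≠ 0) :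
    k ≤ l + 3 ∧ l ≤ k + 3 := by
  have h1 := norm_le_of_LPhat_ne_zero D hξ
  have h2 := le_norm_of_LPhat_ne_zero D (by omega) hξ
  have h3 := norm_le_of_LPhat_ne_zero D hη
  have h4 := norm_le_of_LPhat_ne_zero D h
  have h5 : (2 : ℝ) ^ (j + 3) ≤ 2 ^ k := pow_le_pow_right₀ (by norm_num) hjk
  rw [pow_add] at h5
  have h6 := norm_add_le ξ η
  have h7 : ‖ξ‖ ≤ ‖ξ + η‖ + ‖η‖ := by simpa using norm_sub_le (ξ + η) η
  have h8 : (0 : ℝ) < 2 ^ k := by positivity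
  have h9 : (0 : ℝ) < 2 ^ l := by positivity
  refine ⟨add_three_of_two_pow_le (by linarith), ?_⟩
  rcases Nat.eq_zero_or_pos l with rfl | hl
  · omega
  · have h10 := le_norm_of_LPhat_ne_zero D hl h
    exact add_three_of_two_pow_le (by linarith)

lemma LP_piece_low (D : LPData d) (ha : IsSymbolS11 d m a) (f : 𝓢(RD d, ℂ)) {j k l : ℕ}
    (hjk : j + 3 ≤ k) {x : RD d} (h : LP D l (pdo (symbolPiece D a j k) f) x ≠ 0) :
    k ≤ l + 3 ∧ l ≤ k + 3 := by
  by_contra h'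
  refine h (LP_piece_eq_zero D ha f (fun ξ η hξ hη => ?_) x)
  by_contra h''
  exact h' (LPhat_add_ne_zero D hjk hξ hη h'')

lemma LP_piece_high (D : LPData d) (ha : IsSymbolS11 d m a) (f : 𝓢(RD d, ℂ)) {j k l : ℕ}
    (hjk : k + 3 ≤ j) {x : RD d} (h : LP D l (pdo (symbolPiece D a j k) f) x ≠ 0) :
    j ≤ l + 3 ∧ l ≤ j + 3 := by
  by_contra h'
  refine h (LP_piece_eq_zero D ha f (fun ξ η hξ hη => ?_) x)
  by_contra h''
  rw [add_comm] at h''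
  exact h' (LPhat_add_ne_zero D hjk hη hξ h'')

end FarPart

namespace FarPart

variable {d : ℕ} {m : ℝ} {a : RD d → RD d → ℂ}

/-! ### Pointwise control of the off-diagonal part -/

lemma sum_pdo_symbolPiece (D : LPData d) (ha : IsSymbolS11 d m a) (f : 𝓢(RD d, ℂ)) (J k : ℕ)
    (x : RD d) :
    ∑ j ∈ Finset.range (J + 1), pdo (symbolPiece D a j k) f x =
      pdo (fun x ξ => symConv D.Φ a (2 ^ J) x ξ * LPhat D k ξ) f x := by
  obtain ⟨g, hg, -, hle⟩ := exists_piece_integrand_le D ha f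
  simp only [pdo_symbolPiece]
  rw [← integral_finsetSum]
  · simp only [pdo, ← sum_symConv D ha, Finset.sum_mul, osc]
  · intro j _
    refine (hg.const_mul (((2 : ℝ) ^ j)⁻¹ * ((2 : ℝ) ^ k)⁻¹)).mono' ?_
      (Eventually.of_forall fun ξ => hle j k x ξ)
    exact ((stronglyMeasurable_piece_integrand D ha j k f).comp_measurable
      measurable_prodMk_left).aestronglyMeasurable

lemma exists_norm_LP_low_le (D : LPData d) (ha : IsSymbolS11 d m a) {σ : ℝ} (hσ : 0 ≤ σ) :
    ∃ C : ℝ, 0 ≤ C ∧ ∀ (f h : 𝓢(RD d, ℂ)) (k l : ℕ),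
      (∀ ξ, fourierS h ξ = LPhat D k ξ * fourierS f ξ) → k ≤ l + 3 → ∀ x,
      ‖∑ j ∈ Finset.range (k - 2), LP D l (pdo (symbolPiece D a j k) f) x‖ ≤
        C * ((2 : ℝ) ^ k) ^ m * peetreFun σ k h x := by
  obtain ⟨N, hN⟩ := exists_nat_gt (σ + d)
  obtain ⟨C₁, h1, hC₁⟩ := exists_norm_cutKer_symConv_le D.Φ ha N
  obtain ⟨C₂, h2, hC₂⟩ := exists_norm_LP_le_peetreFun D hσ
  have hW := wtMass_nonneg (d := d) (N - σ)
  refine ⟨C₂ * (C₁ * wtMass d (N - σ)), by positivity, fun f h k l hf hkl x => ?_⟩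
  have hp := peetreFun_nonneg (σ := σ) (k := k) (h := h) x
  have hB : ∀ x, ‖h x‖ ≤ SchwartzMap.seminorm ℝ 0 0 h := h.norm_le_seminorm ℝ
  rcases Nat.lt_or_ge k 3 with hk | hk
  · rw [show k - 2 = 0 by omega]
    simp only [Finset.range_zero, Finset.sum_empty, norm_zero]
    positivity
  · rw [LP_sum D ha, show k - 2 = (k - 3) + 1 by omega]
    simp only [sum_pdo_symbolPiece D ha]
    have hA : 0 ≤ C₁ * ((2 : ℝ) ^ k) ^ m * wtMass d (N - σ) := by positivity
    refine (hC₂ k l h _ _ _ hB hkl hA (fun x => ?_) x).trans (le_of_eq (by ring))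
    rw [pdo_symConv_eq D D.Φ ha _ k hf]
    exact norm_integral_kernel_le hσ hB (by linarith) (fun z => hC₁ _ k x z) x

lemma exists_norm_LP_high_le (D : LPData d) (ha : IsSymbolS11 d m a) {σ : ℝ} (hσ : 0 ≤ σ)
    (M : ℕ) :
    ∃ C : ℝ, 0 ≤ C ∧ ∀ (f h : 𝓢(RD d, ℂ)) (j k l : ℕ), 1 ≤ j →
      (∀ ξ, fourierS h ξ = LPhat D k ξ * fourierS f ξ) → k ≤ l + 3 → ∀ x,
      ‖LP D l (pdo (symbolPiece D a j k) f) x‖ ≤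
        C * ((((2 : ℝ) ^ j)⁻¹) ^ M * ((2 : ℝ) ^ k) ^ (m + M)) * peetreFun σ k h x := by
  obtain ⟨N, hN⟩ := exists_nat_gt (σ + d)
  obtain ⟨C₁, h1, hC₁⟩ := (annulusSupported_φ D).exists_norm_cutKer_symConv_le N M ha
  obtain ⟨C₂, h2, hC₂⟩ := exists_norm_LP_le_peetreFun D hσ
  have hW := wtMass_nonneg (d := d) (N - σ)
  refine ⟨C₂ * (C₁ * wtMass d (N - σ)), by positivity, fun f h j k l hj hf hkl x => ?_⟩
  have hB : ∀ x, ‖h x‖ ≤ SchwartzMap.seminorm ℝ 0 0 h := h.norm_le_seminorm ℝ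
  have hA : 0 ≤ C₁ * ((((2 : ℝ) ^ j)⁻¹) ^ M * ((2 : ℝ) ^ k) ^ (m + M)) * wtMass d (N - σ) := by
    positivity
  refine (hC₂ k l h _ _ _ hB hkl hA (fun x => ?_) x).trans (le_of_eq (by ring))
  obtain ⟨i, rfl⟩ : ∃ i, j = i + 1 := ⟨j - 1, by omega⟩
  rw [show symbolPiece D a (i + 1) k = fun x ξ => _ from
    funext fun x => funext fun ξ => symbolPiece_eq D a (i + 1) k x ξ]
  rw [pdo_symConv_eq D (lpProfile D (i + 1)) ha _ k hf]
  exact norm_integral_kernel_le hσ hB (by linarith)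
    (fun z => hC₁ _ (by positivity) k x z) x

/-- Almost orthogonality: the `l`-th piece of the off-diagonal part only sees frequencies
`2^k` with `k ≤ l + 3`, with arbitrary decay in `l - k`. -/
lemma exists_norm_LP_Sfar_le (D : LPData d) (ha : IsSymbolS11 d m a) {σ : ℝ} (hσ : 0 ≤ σ)
    (M : ℕ) :
    ∃ C : ℝ, 0 ≤ C ∧ ∀ (f : 𝓢(RD d, ℂ)) (h : ℕ → 𝓢(RD d, ℂ)),
      (∀ k ξ, fourierS (h k) ξ = LPhat D k ξ * fourierS f ξ) → ∀ l x,
      ‖LP D l (Sfar D a f) x‖ ≤ C * ∑ k ∈ Finset.range (l + 4),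
        (((2 : ℝ) ^ l)⁻¹) ^ M * ((2 : ℝ) ^ k) ^ (m + M) * peetreFun σ k (h k) x := by
  obtain ⟨C₁, h1, hC₁⟩ := exists_norm_LP_low_le D ha hσ
  obtain ⟨C₂, h2, hC₂⟩ := exists_norm_LP_high_le D ha hσ M
  refine ⟨(C₁ + 7 * C₂) * 8 ^ M, by positivity, fun f h hf l x => ?_⟩
  let F : ℕ → ℕ → ℂ := fun j k => LP D l (pdo (symbolPiece D a j k) f) x
  have hlow : ∀ j k, j + 3 ≤ k → F j k ≠ 0 → k ≤ l + 3 ∧ l ≤ k + 3 := fun j k hjk =>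
    LP_piece_low D ha f hjk
  have hhigh : ∀ j k, k + 3 ≤ j → F j k ≠ 0 → j ≤ l + 3 ∧ l ≤ j + 3 := fun j k hjk =>
    LP_piece_high D ha f hjk
  have habs : ∀ j k : ℕ, 3 ≤ |(j : ℤ) - (k : ℤ)| ↔ j + 3 ≤ k ∨ k + 3 ≤ j := by
    intro j k
    rw [le_abs]
    omega
  have hts : LP D l (Sfar D a f) x = ∑ k ∈ Finset.range (l + 4), ∑ j ∈ Finset.range (l + 4),
      if 3 ≤ |(j : ℤ) - (k : ℤ)| then F j k else 0 := by
    rw [LP_Sfar D ha, tsum_eq_sum (s := Finset.range (l + 4) ×ˢ Finset.range (l + 4)),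
      Finset.sum_product_right]
    rintro ⟨j, k⟩ hjk
    simp only [Finset.mem_product, Finset.mem_range, habs] at hjk ⊢
    rw [ite_eq_right_iff]
    intro hfar
    by_contra hne
    rcases hfar with hfar | hfar
    · have := hlow j k hfar hne
      omega
    · have := hhigh j k hfar hne
      omega
  rw [hts, Finset.mul_sum]
  refine norm_sum_le_of_le _ fun k hk => ?_
  rw [Finset.mem_range] at hk
  have hp := peetreFun_nonneg (σ := σ) (k := k) (h := h k) x
  set P := peetreFun σ k (h k) x
  have hM : ∀ i, l ≤ i + 3 → (((2 : ℝ) ^ i)⁻¹) ^ M ≤ 8 ^ M * (((2 : ℝ) ^ l)⁻¹) ^ M := by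
    intro i hi
    rw [← mul_pow]
    gcongr
    rw [← div_eq_mul_inv, le_div_iff₀ (by positivity), inv_mul_le_iff₀ (by positivity)]
    calc (2 : ℝ) ^ l ≤ 2 ^ (i + 3) := pow_le_pow_right₀ (by norm_num) hi
      _ = _ := by ring
  have hkM : ((2 : ℝ) ^ k) ^ m = (((2 : ℝ) ^ k)⁻¹) ^ M * ((2 : ℝ) ^ k) ^ (m + M) := by
    rw [Real.rpow_add (by positivity), Real.rpow_natCast, inv_pow]
    field_simp
  have hsplit : (∑ j ∈ Finset.range (l + 4), if 3 ≤ |(j : ℤ) - (k : ℤ)| then F j k else 0) =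
      ∑ j ∈ Finset.range (k - 2), F j k +
        ∑ j ∈ (Finset.range (l + 4)).filter (fun j => k + 3 ≤ j), F j k := by
    have e : Finset.range (k - 2) = (Finset.range (l + 4)).filter (fun j => j + 3 ≤ k) := by
      ext j
      simp only [Finset.mem_range, Finset.mem_filter]
      omega
    rw [e, Finset.sum_filter, Finset.sum_filter, ← Finset.sum_add_distrib]
    refine Finset.sum_congr rfl fun j _ => ?_
    simp only [habs]
    by_cases c1 : j + 3 ≤ k
    · have c2 : ¬ k + 3 ≤ j := by omega
      simp [c1, c2]
    · simp [c1]
  have hL : ‖∑ j ∈ Finset.range (k - 2), F j k‖ ≤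
      C₁ * 8 ^ M * ((((2 : ℝ) ^ l)⁻¹) ^ M * ((2 : ℝ) ^ k) ^ (m + M) * P) := by
    by_cases hlk : l ≤ k + 3
    · refine (hC₁ f (h k) k l (hf k) (by omega) x).trans ?_
      rw [hkM]
      calc _ ≤ C₁ * (8 ^ M * (((2 : ℝ) ^ l)⁻¹) ^ M * ((2 : ℝ) ^ k) ^ (m + M)) * P := by
            gcongr
            exact hM k hlk
        _ = _ := by ring
    · rw [Finset.sum_eq_zero, norm_zero]
      · positivity
      · intro j hj
        by_contra hne
        rw [Finset.mem_range] at hj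
        exact hlk (hlow j k (by omega) hne).2
  have hH : ‖∑ j ∈ (Finset.range (l + 4)).filter (fun j => k + 3 ≤ j), F j k‖ ≤
      7 * (C₂ * 8 ^ M * ((((2 : ℝ) ^ l)⁻¹) ^ M * ((2 : ℝ) ^ k) ^ (m + M) * P)) := by
    have hsub : ∑ j ∈ (Finset.Ico (l - 3) (l + 4)).filter (fun j => k + 3 ≤ j), F j k =
        ∑ j ∈ (Finset.range (l + 4)).filter (fun j => k + 3 ≤ j), F j k := by
      refine Finset.sum_subset (fun j hj => ?_) fun j hj hj' => ?_
      · simp only [Finset.mem_filter, Finset.mem_Ico, Finset.mem_range] at hj ⊢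
        omega
      · simp only [Finset.mem_filter, Finset.mem_Ico, Finset.mem_range] at hj hj'
        by_contra hne
        have := hhigh j k hj.2 hne
        omega
    rw [← hsub]
    calc _ ≤ ∑ j ∈ (Finset.Ico (l - 3) (l + 4)).filter (fun j => k + 3 ≤ j),
          C₂ * 8 ^ M * ((((2 : ℝ) ^ l)⁻¹) ^ M * ((2 : ℝ) ^ k) ^ (m + M) * P) := by
          refine norm_sum_le_of_le _ fun j hj => ?_
          simp only [Finset.mem_filter, Finset.mem_Ico] at hj
          refine (hC₂ f (h k) j k l (by omega) (hf k) (by omega) x).trans ?_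
          calc _ ≤ C₂ * (8 ^ M * (((2 : ℝ) ^ l)⁻¹) ^ M * ((2 : ℝ) ^ k) ^ (m + M)) * P := by
                gcongr
                exact hM j (by omega)
            _ = _ := by ring
      _ ≤ _ := by
          rw [Finset.sum_const, nsmul_eq_mul]
          gcongr
          have h7 := (Finset.card_filter_le (Finset.Ico (l - 3) (l + 4)) (fun j => k + 3 ≤ j)).trans
            (show (Finset.Ico (l - 3) (l + 4)).card ≤ 7 by rw [Nat.card_Ico]; omega)
          exact_mod_cast h7
  rw [hsplit]
  calc _ ≤ _ := norm_add_le _ _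
    _ ≤ _ := add_le_add hL hH
    _ = _ := by ring

end FarPart

namespace FarPart

variable {d : ℕ}

/-! ### Averages over dyadic cubes -/

lemma dyadicCube_eq_preimage (μ : ℤ) (n : Fin d → ℤ) :
    dyadicCube d μ n = (WithLp.ofLp : RD d → Fin d → ℝ) ⁻¹'
      (Set.univ.pi fun i =>
        Set.Ico ((n i : ℝ) * (2 : ℝ) ^ (-μ)) (((n i : ℝ) + 1) * (2 : ℝ) ^ (-μ))) := by
  ext x
  simp [dyadicCube, Set.mem_pi]

lemma measurableSet_dyadicCube (μ : ℤ) (n : Fin d → ℤ) : MeasurableSet (dyadicCube d μ n) := by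
  rw [dyadicCube_eq_preimage]
  exact (PiLp.volume_preserving_ofLp (Fin d)).measurable
    (MeasurableSet.univ_pi fun i => measurableSet_Ico)

lemma two_rpow_mul_volume_dyadicCube (μ : ℕ) (n : Fin d → ℤ) :
    (2 : ℝ≥0∞) ^ ((μ : ℝ) * (d : ℝ)) * volume (dyadicCube d μ n) = 1 := by
  rw [dyadicCube_eq_preimage, (PiLp.volume_preserving_ofLp (Fin d)).measure_preimage
    (MeasurableSet.univ_pi fun i => measurableSet_Ico).nullMeasurableSet, Real.volume_pi_Ico]
  have h : ∀ i, ((n i : ℝ) + 1) * (2 : ℝ) ^ (-(μ : ℤ)) - (n i : ℝ) * (2 : ℝ) ^ (-(μ : ℤ))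
      = ((2 : ℝ) ^ μ)⁻¹ := fun i => by rw [zpow_neg, zpow_natCast]; ring
  simp only [h, Finset.prod_const, Finset.card_univ, Fintype.card_fin]
  rw [ENNReal.rpow_mul, ENNReal.rpow_natCast, ENNReal.rpow_natCast, ← mul_pow,
    ENNReal.ofReal_inv_of_pos (by positivity), ENNReal.ofReal_pow (by norm_num),
    ENNReal.ofReal_ofNat, ENNReal.mul_inv_cancel (by simp) (by simp), one_pow]

/-- The index of the dyadic cube of level `μ` containing `x`. -/
def cubeIndex (μ : ℕ) (x : RD d) (i : Fin d) : ℤ := ⌊(2 : ℝ) ^ μ * x i⌋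

lemma mem_dyadicCube_iff {μ : ℕ} {n : Fin d → ℤ} {x : RD d} :
    x ∈ dyadicCube d μ n ↔ ∀ i, (n i : ℝ) ≤ 2 ^ μ * x i ∧ 2 ^ μ * x i < n i + 1 := by
  have h : (0 : ℝ) < 2 ^ μ := by positivity
  simp only [dyadicCube, Set.mem_ofPred_eq, zpow_neg, zpow_natCast]
  refine forall_congr' fun i => and_congr ?_ ?_
  · rw [← div_eq_mul_inv, div_le_iff₀ h, mul_comm]
  · rw [← div_eq_mul_inv, lt_div_iff₀ h, mul_comm]

lemma mem_dyadicCube_cubeIndex (μ : ℕ) (x : RD d) : x ∈ dyadicCube d μ (cubeIndex μ x) :=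
  mem_dyadicCube_iff.2 fun _ => ⟨Int.floor_le _, Int.lt_floor_add_one _⟩

lemma two_pow_mul_norm_sub_le {μ : ℕ} {n : Fin d → ℤ} {x y : RD d}
    (hx : x ∈ dyadicCube d μ n) (hy : y ∈ dyadicCube d μ n) : 2 ^ μ * ‖x - y‖ ≤ d := by
  refine abs_le_of_sq_le_sq' ?_ (Nat.cast_nonneg d) |>.2
  rw [mul_pow, EuclideanSpace.norm_sq_eq, Finset.mul_sum]
  calc _ ≤ ∑ _i : Fin d, (1 : ℝ) := by
        refine Finset.sum_le_sum fun i _ => ?_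
        rw [← mul_pow, ← sq_abs, abs_mul, abs_norm, ← Real.norm_eq_abs, ← norm_mul,
          Real.norm_eq_abs, sq_le_one_iff_abs_le_one, abs_abs, abs_le, PiLp.sub_apply, mul_sub]
        have h1 := mem_dyadicCube_iff.1 hx i
        have h2 := mem_dyadicCube_iff.1 hy i
        constructor <;> linarith
    _ = (d : ℝ) := by simp
    _ ≤ (d : ℝ) ^ 2 := by exact_mod_cast Nat.le_self_pow two_ne_zero d

/-- Translating a cube by `v` keeps it in the union of its neighbours at distance `2^μ‖v‖`. -/
lemma sub_mem_iUnion_dyadicCube {μ : ℕ} {n : Fin d → ℤ} {x v : RD d}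
    (hx : x ∈ dyadicCube d μ n) {K : ℕ} (hv : 2 ^ μ * ‖v‖ ≤ K) :
    x - v ∈ ⋃ t ∈ Fintype.piFinset (fun i => Finset.Icc (n i - K) (n i + K)),
      dyadicCube d μ t := by
  refine Set.mem_biUnion (x := cubeIndex μ (x - v)) ?_ (mem_dyadicCube_cubeIndex μ _)
  simp only [Finset.mem_coe, Fintype.mem_piFinset, Finset.mem_Icc, cubeIndex]
  intro i
  have h1 := mem_dyadicCube_iff.1 hx i
  have h2 : |2 ^ μ * v i| ≤ K := by
    rw [abs_mul, abs_of_pos (by positivity)]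
    refine le_trans ?_ hv
    gcongr
    exact PiLp.norm_apply_le v i
  rw [abs_le] at h2
  constructor
  · rw [Int.le_floor]
    push_cast
    simp only [PiLp.sub_apply]
    linarith
  · rw [← Int.lt_add_one_iff, Int.floor_lt]
    push_cast
    simp only [PiLp.sub_apply]
    linarith

lemma sum_lintegral_translate_le {μ : ℕ} (n : Fin d → ℤ) {G : ℕ → RD d → ℝ≥0∞}
    (hG : ∀ j, Measurable (G j)) {v : ℕ → RD d} {K : ℕ} (hv : ∀ j, 2 ^ μ * ‖v j‖ ≤ K) :
    ∑' j, ∫⁻ x in dyadicCube d μ n, G j (x - v j) ≤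
      ((2 * K + 1) ^ d : ℕ) * ⨆ t, ∫⁻ x in dyadicCube d μ t, ∑' j, G j x := by
  set T := Fintype.piFinset (fun i => Finset.Icc (n i - K) (n i + K)) with hT
  have hcard : T.card = (2 * K + 1) ^ d := by
    rw [hT, Fintype.card_piFinset]
    have : ∀ i, (Finset.Icc (n i - (K : ℤ)) (n i + K)).card = 2 * K + 1 := fun i => by
      rw [Int.card_Icc]; omega
    simp [this]
  have h1 : ∀ j, ∫⁻ x in dyadicCube d μ n, G j (x - v j) ≤
      ∑ t ∈ T, ∫⁻ x in dyadicCube d μ t, G j x := by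
    intro j
    calc ∫⁻ x in dyadicCube d μ n, G j (x - v j)
        ≤ ∫⁻ x in (fun x => x - v j) ⁻¹' (⋃ t ∈ T, dyadicCube d μ t), G j (x - v j) :=
          lintegral_mono_set fun x hx => sub_mem_iUnion_dyadicCube hx (hv j)
      _ = ∫⁻ x in ⋃ t ∈ T, dyadicCube d μ t, G j x :=
          (measurePreserving_sub_right volume (v j)).setLIntegral_comp_preimage
            (T.measurableSet_biUnion fun t _ => measurableSet_dyadicCube _ t) (hG j)
      _ ≤ _ := by
        have hU : ⋃ t ∈ T, dyadicCube d μ t = ⋃ t : T, dyadicCube d μ t :=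
          (Set.iUnion_subtype (· ∈ T) fun t => dyadicCube d μ t).symm
        rw [hU]
        refine (lintegral_iUnion_le _ _).trans_eq ?_
        rw [tsum_fintype]
        exact Finset.sum_coe_sort T fun t => ∫⁻ x in dyadicCube d μ t, G j x
  calc _ ≤ ∑' j, ∑ t ∈ T, ∫⁻ x in dyadicCube d μ t, G j x := ENNReal.tsum_le_tsum h1
    _ = ∑ t ∈ T, ∫⁻ x in dyadicCube d μ t, ∑' j, G j x := by
        rw [Summable.tsum_finsetSum fun t _ => ENNReal.summable]
        exact Finset.sum_congr rfl fun t _ =>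
          (lintegral_tsum fun j => (hG j).aemeasurable).symm
    _ ≤ ∑ t ∈ T, ⨆ t, ∫⁻ x in dyadicCube d μ t, ∑' j, G j x :=
        Finset.sum_le_sum fun t _ => le_iSup (fun t => ∫⁻ x in dyadicCube d μ t, ∑' j, G j x) t
    _ = _ := by rw [Finset.sum_const, hcard, nsmul_eq_mul]

/-- Averages at the scales `2^{-(μ+j)}` are controlled by averages over cubes of level `μ`. -/
lemma lintegral_tsum_average_le {L : ℝ} (hL : 2 * d < L) (μ : ℕ) (n : Fin d → ℤ)
    {G : ℕ → RD d → ℝ≥0∞} (hG : ∀ j, Measurable (G j)) :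
    ∫⁻ x in dyadicCube d μ n, ∑' j, ∫⁻ z, ENNReal.ofReal ((1 + ‖z‖) ^ (-L)) *
        G j (x - ((2 : ℝ) ^ (μ + j))⁻¹ • z) ≤
      ENNReal.ofReal (5 ^ d * wtMass d (L - d)) *
        ⨆ t, ∫⁻ x in dyadicCube d μ t, ∑' j, G j x := by
  have hw : Measurable fun z : RD d => ENNReal.ofReal ((1 + ‖z‖) ^ (-L)) := by fun_prop
  have hG2 : ∀ j, Measurable fun p : RD d × RD d => ENNReal.ofReal ((1 + ‖p.2‖) ^ (-L)) *
      G j (p.1 - ((2 : ℝ) ^ (μ + j))⁻¹ • p.2) := fun j =>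
    (hw.comp measurable_snd).mul ((hG j).comp (by fun_prop))
  have hG3 : ∀ j z, Measurable fun x : RD d => G j (x - ((2 : ℝ) ^ (μ + j))⁻¹ • z) := fun j z =>
    (hG j).comp (by fun_prop)
  set A := ⨆ t, ∫⁻ x in dyadicCube d μ t, ∑' j, G j x with hA
  have h_int : Integrable (fun z : RD d => (1 + ‖z‖) ^ (-(L - d))) :=
    integrable_one_add_norm (by simp; linarith)
  rw [lintegral_tsum fun j => (hG2 j).lintegral_prod_right'.aemeasurable]
  have h1 : ∀ j, ∫⁻ x in dyadicCube d μ n, ∫⁻ z, ENNReal.ofReal ((1 + ‖z‖) ^ (-L)) *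
        G j (x - ((2 : ℝ) ^ (μ + j))⁻¹ • z) = ∫⁻ z, ENNReal.ofReal ((1 + ‖z‖) ^ (-L)) *
        ∫⁻ x in dyadicCube d μ n, G j (x - ((2 : ℝ) ^ (μ + j))⁻¹ • z) := by
    intro j
    rw [lintegral_lintegral_swap (hG2 j).aemeasurable]
    exact lintegral_congr fun z => lintegral_const_mul _ (hG3 j z)
  simp only [h1]
  have h2 : ∀ j, Measurable fun z : RD d => ENNReal.ofReal ((1 + ‖z‖) ^ (-L)) *
      ∫⁻ x in dyadicCube d μ n, G j (x - ((2 : ℝ) ^ (μ + j))⁻¹ • z) := fun j =>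
    hw.mul (Measurable.lintegral_prod_right'
      (f := fun p : RD d × RD d => G j (p.2 - ((2 : ℝ) ^ (μ + j))⁻¹ • p.1))
      ((hG j).comp (by fun_prop)))
  rw [← lintegral_tsum fun j => (h2 j).aemeasurable]
  simp only [ENNReal.tsum_mul_left]
  calc _ ≤ ∫⁻ z : RD d, ENNReal.ofReal (5 ^ d * (1 + ‖z‖) ^ (-(L - d))) * A := by
        refine lintegral_mono fun z => ?_
        have hK : ∀ j, (2 : ℝ) ^ μ * ‖((2 : ℝ) ^ (μ + j))⁻¹ • z‖ ≤ ⌈‖z‖⌉₊ := by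
          intro j
          refine le_trans ?_ (Nat.le_ceil _)
          rw [norm_smul, Real.norm_of_nonneg (by positivity), pow_add, ← mul_assoc, mul_inv,
            ← mul_assoc, mul_inv_cancel₀ (by positivity), one_mul]
          exact mul_le_of_le_one_left (norm_nonneg _)
            (inv_le_one_of_one_le₀ (one_le_pow₀ (by norm_num)))
        refine (mul_le_mul_right (sum_lintegral_translate_le n hG hK) _).trans ?_
        rw [← mul_assoc]
        refine mul_le_mul_left ?_ _
        rw [← ENNReal.ofReal_natCast, ← ENNReal.ofReal_mul (by positivity)]
        refine ENNReal.ofReal_le_ofReal ?_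
        have h5 : ((2 * ⌈‖z‖⌉₊ + 1 : ℕ) : ℝ) ≤ 5 * (1 + ‖z‖) := by
          have := Nat.ceil_lt_add_one (norm_nonneg z)
          have := norm_nonneg z
          push_cast
          linarith
        have h6 : (1 + ‖z‖) ^ (-(L - d)) = (1 + ‖z‖) ^ (-L) * (1 + ‖z‖) ^ d := by
          rw [← Real.rpow_natCast, ← Real.rpow_add (by positivity)]
          ring_nf
        calc _ ≤ (1 + ‖z‖) ^ (-L) * (5 * (1 + ‖z‖)) ^ d := by
              rw [Nat.cast_pow]; gcongr
          _ = _ := by rw [h6, mul_pow]; ring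
    _ = _ := by
        rw [lintegral_mul_const _ (by fun_prop), ← ofReal_integral_eq_lintegral_ofReal
          (h_int.const_mul _) (Eventually.of_forall fun z => by positivity), integral_const_mul,
          wtMass]

end FarPart

namespace FarPart

/-! ### A discrete Hardy inequality -/

lemma two_inv_eq_mul :
    (2⁻¹ : ℝ≥0∞) = (2 : ℝ≥0∞) ^ (-(1 / 2) : ℝ) * (2 : ℝ≥0∞) ^ (-(1 / 2) : ℝ) := by
  rw [← ENNReal.rpow_add _ _ (by simp) (by simp), ← ENNReal.rpow_neg_one]
  norm_num

lemma two_rpow_neg_lt_one {r : ℝ} (hr : 0 < r) : (2 : ℝ≥0∞) ^ (-r) < 1 :=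
  ENNReal.rpow_lt_one_of_one_lt_of_neg (by norm_num) (by linarith)

lemma tsum_pow_ne_top {t : ℝ≥0∞} (ht : t < 1) : ∑' n : ℕ, t ^ n ≠ ⊤ := by
  rw [ENNReal.tsum_geometric, Ne, ENNReal.inv_eq_top, tsub_eq_zero_iff_le, not_le]
  exact ht

lemma tsum_pow_mul_ne_top {t : ℝ≥0∞} (ht : t < 1) : ∑' n : ℕ, t ^ n * n ≠ ⊤ := by
  lift t to ℝ≥0 using ht.ne_top
  have ht' : (t : ℝ) < 1 := by exact_mod_cast ht
  have h := summable_pow_mul_geometric_of_norm_lt_one 1 (r := (t : ℝ)) (by simpa using ht')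
  have h2 : Summable (fun n : ℕ => t ^ n * (n : ℝ≥0)) := by
    rw [← NNReal.summable_coe]
    refine h.congr fun n => ?_
    push_cast
    ring
  have h3 := ENNReal.tsum_coe_ne_top_iff_summable.2 h2
  simpa using h3

lemma sum_pow_mul_rpow_le {q : ℝ} (hq : 0 < q) (e : ℕ → ℝ≥0∞) (N : ℕ) :
    (∑ n ∈ Finset.range N, (2⁻¹ : ℝ≥0∞) ^ n * e n) ^ q ≤
      (∑' n : ℕ, ((2 : ℝ≥0∞) ^ (-(1 / 2) : ℝ)) ^ n) ^ q *
        ∑ n ∈ Finset.range N, ((2 : ℝ≥0∞) ^ (-(q / 2))) ^ n * e n ^ q := by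
  set t := (2 : ℝ≥0∞) ^ (-(1 / 2) : ℝ) with ht
  have htq : ∀ n : ℕ, ((2 : ℝ≥0∞) ^ (-(q / 2))) ^ n * e n ^ q = (t ^ n * e n) ^ q := fun n => by
    rw [ENNReal.mul_rpow_of_nonneg _ _ hq.le, ht, ← ENNReal.rpow_natCast, ← ENNReal.rpow_natCast,
      ← ENNReal.rpow_mul, ← ENNReal.rpow_mul, ← ENNReal.rpow_mul]
    ring_nf
  simp only [htq]
  set B := ∑ n ∈ Finset.range N, (t ^ n * e n) ^ q with hB
  have h1 : ∀ n ∈ Finset.range N, t ^ n * e n ≤ B ^ (1 / q) := fun n hn => by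
    rw [one_div, ENNReal.le_rpow_inv_iff hq]
    exact Finset.single_le_sum (f := fun n => (t ^ n * e n) ^ q) (fun _ _ => zero_le) hn
  calc _ ≤ (∑ n ∈ Finset.range N, t ^ n * B ^ (1 / q)) ^ q := by
        refine ENNReal.rpow_le_rpow (Finset.sum_le_sum fun n hn => ?_) hq.le
        rw [two_inv_eq_mul, ← ht, mul_pow, mul_assoc]
        exact mul_le_mul_right (h1 n hn) _
    _ ≤ ((∑' n : ℕ, t ^ n) * B ^ (1 / q)) ^ q := by
        rw [← Finset.sum_mul]
        exact ENNReal.rpow_le_rpow (mul_le_mul_left (ENNReal.sum_le_tsum _) _) hq.le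
    _ = _ := by
        rw [ENNReal.mul_rpow_of_nonneg _ _ hq.le, ← ENNReal.rpow_mul, one_div_mul_cancel hq.ne',
          ENNReal.rpow_one]

lemma tsum_shift_le (e : ℕ → ℝ≥0∞) (n μ : ℕ) {S : ℝ≥0∞} (hS : ∀ k < μ, e k ≤ S) :
    ∑' j : ℕ, (if n < μ + j + 4 then e (μ + j + 3 - n) else 0) ≤
      n * S + ∑' j, e (μ + j) := by
  have h1 : ∀ j, (if n < μ + j + 4 then e (μ + j + 3 - n) else 0) ≤
      (if j < n then S else 0) + if n ≤ j + 3 then e (μ + (j + 3 - n)) else 0 := by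
    intro j
    rcases le_or_gt n (j + 3) with h | h
    · rw [if_pos h, if_pos (by omega), show μ + j + 3 - n = μ + (j + 3 - n) by omega]
      exact le_add_self
    · split_ifs <;> first | omega | exact (hS _ (by omega)).trans le_self_add | exact zero_le
  refine (ENNReal.tsum_le_tsum h1).trans ?_
  rw [ENNReal.tsum_add]
  refine add_le_add (le_of_eq ?_) ?_
  · rw [tsum_eq_sum (s := Finset.range n) fun j hj => if_neg (by simpa using hj)]
    rw [Finset.sum_congr rfl fun j hj => if_pos (Finset.mem_range.1 hj)]
    simp
  · set u : ℕ → ℝ≥0∞ := fun i => if n ≤ i then e (μ + (i - n)) else 0 with hu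
    calc ∑' j, u (j + 3) ≤ ∑' i, u i :=
          ENNReal.tsum_comp_le_tsum_of_injective (add_left_injective 3) u
      _ = ∑' i, u (i + n) := by
          have h2 : ∑ i ∈ Finset.range n, u i = 0 :=
            Finset.sum_eq_zero fun i hi => if_neg (by simpa using hi)
          rw [← ENNReal.summable.sum_add_tsum_nat_add' (f := u) (k := n), h2, zero_add]
      _ = _ := by simp [hu]

lemma exists_tsum_rpow_le {q : ℝ} (hq : 0 < q) : ∃ C : ℝ≥0∞, C ≠ ⊤ ∧ ∀ e F : ℕ → ℝ≥0∞,
    (∀ l, F l ≤ ∑ k ∈ Finset.range (l + 4), (2⁻¹ : ℝ≥0∞) ^ (l + 3 - k) * e k) →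
    ∀ (μ : ℕ) (S : ℝ≥0∞), (∀ k < μ, e k ≤ S) →
      ∑' j, F (μ + j) ^ q ≤ C * (S ^ q + ∑' j, e (μ + j) ^ q) := by
  set A := (∑' n : ℕ, ((2 : ℝ≥0∞) ^ (-(1 / 2) : ℝ)) ^ n) ^ q with hA
  have hA' : A ≠ ⊤ := ENNReal.rpow_ne_top_of_nonneg hq.le
    (tsum_pow_ne_top (two_rpow_neg_lt_one (by norm_num)))
  set ρ := (2 : ℝ≥0∞) ^ (-(q / 2)) with hρ
  have hρ1 : ρ < 1 := two_rpow_neg_lt_one (by linarith)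
  refine ⟨A * (∑' n : ℕ, ρ ^ n * n + ∑' n : ℕ, ρ ^ n), ENNReal.mul_ne_top hA'
    (ENNReal.add_ne_top.2 ⟨tsum_pow_mul_ne_top hρ1, tsum_pow_ne_top hρ1⟩), fun e F hF μ S hS => ?_⟩
  set T := ∑' j, e (μ + j) ^ q with hT
  have h1 : ∀ l, F l ^ q ≤ A * ∑ n ∈ Finset.range (l + 4), ρ ^ n * e (l + 3 - n) ^ q := by
    intro l
    refine (ENNReal.rpow_le_rpow (hF l) hq.le).trans ?_
    rw [← Finset.sum_range_reflect]
    refine le_trans (le_of_eq ?_) (sum_pow_mul_rpow_le hq (fun n => e (l + 3 - n)) (l + 4))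
    congr 1
    refine Finset.sum_congr rfl fun n hn => ?_
    rw [Finset.mem_range] at hn
    rw [show l + 3 - (l + 4 - 1 - n) = n by omega, show l + 4 - 1 - n = l + 3 - n by omega]
  calc ∑' j, F (μ + j) ^ q
      ≤ ∑' j, A * ∑' n, ρ ^ n * (if n < μ + j + 4 then e (μ + j + 3 - n) ^ q else 0) := by
        refine ENNReal.tsum_le_tsum fun j => (h1 _).trans (mul_le_mul_right ?_ _)
        refine le_trans (le_of_eq (Finset.sum_congr rfl fun n hn => ?_))
          (ENNReal.sum_le_tsum (Finset.range (μ + j + 4)))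
        rw [if_pos (Finset.mem_range.1 hn)]
    _ = A * ∑' n, ρ ^ n * ∑' j, (if n < μ + j + 4 then e (μ + j + 3 - n) ^ q else 0) := by
        rw [ENNReal.tsum_mul_left, ENNReal.tsum_comm]
        simp only [ENNReal.tsum_mul_left]
    _ ≤ A * ∑' n : ℕ, ρ ^ n * (n * S ^ q + T) := by
        refine mul_le_mul_right (ENNReal.tsum_le_tsum fun n => mul_le_mul_right ?_ _) _
        exact tsum_shift_le (fun k => e k ^ q) n μ fun k hk => ENNReal.rpow_le_rpow (hS k hk) hq.le
    _ = A * ((∑' n : ℕ, ρ ^ n * n) * S ^ q + (∑' n : ℕ, ρ ^ n) * T) := by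
        rw [← ENNReal.tsum_mul_right, ← ENNReal.tsum_mul_right, ← ENNReal.tsum_add]
        congr 2
        ext n
        ring
    _ ≤ _ := by
        rw [mul_assoc]
        refine mul_le_mul_right ?_ _
        rw [mul_add]
        exact add_le_add (mul_le_mul_left le_self_add _) (mul_le_mul_left le_add_self _)

end FarPart

namespace FarPart

variable {d : ℕ} {m : ℝ} {a : RD d → RD d → ℂ}

/-! ### The local estimate -/

/-- The family `h` consists of the Littlewood–Paley pieces of `f`. -/
def IsLPPieces (D : LPData d) (f : 𝓢(RD d, ℂ)) (h : ℕ → 𝓢(RD d, ℂ)) : Prop :=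
  ∀ k ξ, fourierS (h k) ξ = LPhat D k ξ * fourierS f ξ

/-- The `q`-th power of the quantity `cubePiece`, for nonnegative functions. -/
def cubeEnergy (d μ : ℕ) (n : Fin d → ℤ) (s q : ℝ) (g : ℕ → RD d → ℝ≥0∞) : ℝ≥0∞ :=
  (2 : ℝ≥0∞) ^ ((μ : ℝ) * (d : ℝ)) *
    ∫⁻ x in dyadicCube d μ n, ∑' j : ℕ,
      ((2 : ℝ≥0∞) ^ (s * ((μ + j : ℕ) : ℝ)) * g (μ + j) x) ^ q

lemma cubePiece_eq {q : ℝ} (hq : 0 < q) (μ : ℕ) (n : Fin d → ℤ) (s : ℝ) (g : ℕ → RD d → ℂ) :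
    cubePiece d μ n μ s q g = cubeEnergy d μ n s q (fun k x => ‖g k x‖ₑ) ^ (1 / q) := by
  simp only [cubePiece, cubeEnergy, ENNReal.mul_rpow_of_nonneg _ _ hq.le, ← ENNReal.rpow_mul,
    Nat.cast_add, enorm_eq_nnnorm]

lemma ofReal_integral_wt_mul_le (L : ℝ) (k : ℕ) {g : RD d → ℝ} (hg : ∀ y, 0 ≤ g y) :
    ENNReal.ofReal (∫ y, wt d L k y * g y) ≤
      ∫⁻ z, ENNReal.ofReal ((1 + ‖z‖) ^ (-L)) * ENNReal.ofReal (g (((2 : ℝ) ^ k)⁻¹ • z)) := by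
  have h1 : ∫ y, wt d L k y * g y = ∫ z : RD d, (1 + ‖z‖) ^ (-L) * g (((2 : ℝ) ^ k)⁻¹ • z) := by
    have h2 := Measure.integral_comp_smul (volume : Measure (RD d))
      (fun z => (1 + ‖z‖) ^ (-L) * g (((2 : ℝ) ^ k)⁻¹ • z)) ((2 : ℝ) ^ k)
    rw [finrank_euclideanSpace_fin, abs_of_pos (by positivity), smul_eq_mul,
      eq_inv_mul_iff_mul_eq₀ (by positivity), ← integral_const_mul] at h2
    rw [← h2]
    refine integral_congr_ae (Eventually.of_forall fun y => ?_)
    simp only [wt_eq_dilation, inv_smul_smul₀ (show (2 : ℝ) ^ k ≠ 0 by positivity), mul_assoc]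
  rw [h1, ← Real.enorm_of_nonneg (integral_nonneg fun z => mul_nonneg (by positivity) (hg _))]
  refine (enorm_integral_le_lintegral_enorm _).trans_eq (lintegral_congr fun z => ?_)
  rw [Real.enorm_of_nonneg (mul_nonneg (by positivity) (hg _)), ENNReal.ofReal_mul (by positivity)]

lemma exists_cubeEnergy_peetreFun_le (D : LPData d) {q : ℝ} (hq : 0 < q) :
    ∃ σ : ℝ, 0 ≤ σ ∧ ∃ C : ℝ≥0∞, C ≠ ⊤ ∧ ∀ (r : ℝ) (f : 𝓢(RD d, ℂ)) (h : ℕ → 𝓢(RD d, ℂ)),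
      IsLPPieces D f h → ∀ (μ : ℕ) (n : Fin d → ℤ),
        cubeEnergy d μ n r q (fun k x => ENNReal.ofReal (peetreFun σ k (h k) x)) ≤
          C * ⨆ t, cubeEnergy d μ t r q (fun k x => ‖h k x‖ₑ) := by
  set L : ℝ := 2 * d + 1 with hL
  have hLpos : 0 < L := by positivity
  set σ := max L (L / q) with hσ
  have hσ1 : L ≤ σ := le_max_left _ _
  have hσ2 : L ≤ σ * q := by rw [← div_le_iff₀ hq]; exact le_max_right _ _
  obtain ⟨C, hC, hP⟩ := exists_peetreFun_rpow_le D hq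
    (show (d : ℝ) < L by have : (0 : ℝ) ≤ d := Nat.cast_nonneg d
                         linarith) hσ1 hσ2
  refine ⟨σ, hLpos.le.trans hσ1, ENNReal.ofReal C * ENNReal.ofReal (5 ^ d * wtMass d (L - d)),
    by finiteness, fun r f h hh μ n => ?_⟩
  set G : ℕ → RD d → ℝ≥0∞ := fun j x =>
    ((2 : ℝ≥0∞) ^ (r * ((μ + j : ℕ) : ℝ)) * ‖h (μ + j) x‖ₑ) ^ q with hG
  have hGm : ∀ j, Measurable (G j) := fun j =>
    ((h (μ + j)).continuous.measurable.enorm.const_mul _).pow_const q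
  have h1 : ∀ j x, ((2 : ℝ≥0∞) ^ (r * ((μ + j : ℕ) : ℝ)) *
      ENNReal.ofReal (peetreFun σ (μ + j) (h (μ + j)) x)) ^ q ≤ ENNReal.ofReal C *
        ∫⁻ z, ENNReal.ofReal ((1 + ‖z‖) ^ (-L)) * G j (x - ((2 : ℝ) ^ (μ + j))⁻¹ • z) := by
    intro j x
    have h2 : ∀ z, ENNReal.ofReal ((1 + ‖z‖) ^ (-L)) * G j (x - ((2 : ℝ) ^ (μ + j))⁻¹ • z) =
        ((2 : ℝ≥0∞) ^ (r * ((μ + j : ℕ) : ℝ))) ^ q * (ENNReal.ofReal ((1 + ‖z‖) ^ (-L)) *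
          ENNReal.ofReal (‖h (μ + j) (x - ((2 : ℝ) ^ (μ + j))⁻¹ • z)‖ ^ q)) := fun z => by
      simp only [hG]
      rw [ENNReal.mul_rpow_of_nonneg _ _ hq.le,
        ← ENNReal.ofReal_rpow_of_nonneg (norm_nonneg _) hq.le, ofReal_norm]
      ring
    have h3 : ((2 : ℝ≥0∞) ^ (r * ((μ + j : ℕ) : ℝ))) ^ q ≠ ⊤ := by
      rw [← ENNReal.rpow_mul]
      exact ENNReal.rpow_ne_top_of_ne_zero (by norm_num) (by norm_num)
    simp only [h2]
    rw [lintegral_const_mul' _ _ h3, ENNReal.mul_rpow_of_nonneg _ _ hq.le,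
      ENNReal.ofReal_rpow_of_nonneg (peetreFun_nonneg x) hq.le, mul_left_comm]
    refine mul_le_mul_right ?_ _
    refine (ENNReal.ofReal_le_ofReal (hP (μ + j) f (h (μ + j)) (hh _) x)).trans ?_
    rw [ENNReal.ofReal_mul hC]
    exact mul_le_mul_right (ofReal_integral_wt_mul_le L (μ + j)
      (g := fun y => ‖h (μ + j) (x - y)‖ ^ q) fun y => by positivity) _
  simp only [cubeEnergy]
  rw [← ENNReal.mul_iSup, mul_left_comm]
  refine mul_le_mul_right ?_ _
  refine (lintegral_mono fun x => ENNReal.tsum_le_tsum fun j => h1 j x).trans ?_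
  simp only [ENNReal.tsum_mul_left]
  rw [lintegral_const_mul' _ _ ENNReal.ofReal_ne_top, mul_assoc]
  exact mul_le_mul_right (lintegral_tsum_average_le (by linarith) μ n hGm) _

lemma two_rpow_weight_le {s m : ℝ} {M k l : ℕ} (hM : s + 1 ≤ M) (hkl : k < l + 4) :
    (2 : ℝ) ^ (s * l) * ((((2 : ℝ) ^ l)⁻¹) ^ M * ((2 : ℝ) ^ k) ^ (m + M)) ≤
      2 ^ (3 * (M - s)) * (2⁻¹ ^ (l + 3 - k) * 2 ^ ((s + m) * k)) := by
  have h2 : (0 : ℝ) < 2 := by norm_num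
  have hk : ((l + 3 - k : ℕ) : ℝ) = l + 3 - k := by
    rw [Nat.cast_sub (by omega)]; push_cast; ring
  simp only [← Real.rpow_natCast, ← Real.rpow_neg_one (2 : ℝ), ← Real.rpow_mul h2.le,
    ← Real.rpow_neg h2.le, ← Real.rpow_add h2, hk]
  refine Real.rpow_le_rpow_of_exponent_le (by norm_num) ?_
  have hn : (0 : ℝ) ≤ l + 3 - k := hk ▸ Nat.cast_nonneg _
  nlinarith [mul_nonneg hn (sub_nonneg.2 hM)]

lemma exists_enorm_LP_Sfar_le (D : LPData d) (ha : IsSymbolS11 d m a) {σ : ℝ} (hσ : 0 ≤ σ)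
    (s : ℝ) : ∃ C : ℝ≥0, ∀ (f : 𝓢(RD d, ℂ)) (h : ℕ → 𝓢(RD d, ℂ)), IsLPPieces D f h →
      ∀ (l : ℕ) (x : RD d), (2 : ℝ≥0∞) ^ (s * l) * ‖LP D l (Sfar D a f) x‖ₑ ≤
        ∑ k ∈ Finset.range (l + 4), (2⁻¹ : ℝ≥0∞) ^ (l + 3 - k) *
          (C * ((2 : ℝ≥0∞) ^ ((s + m) * k) * ENNReal.ofReal (peetreFun σ k (h k) x))) := by
  obtain ⟨M, hM⟩ := exists_nat_ge (s + 1)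
  obtain ⟨C, hC, hP⟩ := exists_norm_LP_Sfar_le D ha hσ M
  have h2 : ∀ r : ℝ, (2 : ℝ≥0∞) ^ r = ENNReal.ofReal (2 ^ r) := fun r => by
    rw [← ENNReal.ofReal_rpow_of_pos (by norm_num), ENNReal.ofReal_ofNat]
  have h2' : (2⁻¹ : ℝ≥0∞) = ENNReal.ofReal 2⁻¹ := by
    rw [ENNReal.ofReal_inv_of_pos (by norm_num), ENNReal.ofReal_ofNat]
  refine ⟨(C * 2 ^ (3 * (M - s))).toNNReal, fun f h hh l x => ?_⟩
  have hterm : ∀ k : ℕ, (2⁻¹ : ℝ≥0∞) ^ (l + 3 - k) * (((C * 2 ^ (3 * (M - s))).toNNReal : ℝ≥0∞) *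
      ((2 : ℝ≥0∞) ^ ((s + m) * k) * ENNReal.ofReal (peetreFun σ k (h k) x))) =
      ENNReal.ofReal (2⁻¹ ^ (l + 3 - k) * (C * 2 ^ (3 * (M - s)) *
        (2 ^ ((s + m) * k) * peetreFun σ k (h k) x))) := fun k => by
    rw [h2, h2', ← ENNReal.ofReal_pow (by positivity), ← ENNReal.ofReal_mul (by positivity),
      ← ENNReal.ofReal, ← ENNReal.ofReal_mul (by positivity),
      ← ENNReal.ofReal_mul (by positivity)]
  have hpos : ∀ k, 0 ≤ peetreFun σ k (h k) x := fun k => peetreFun_nonneg x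
  simp only [hterm]
  rw [← ENNReal.ofReal_sum_of_nonneg fun k _ => by have := hpos k; positivity, h2, ← ofReal_norm,
    ← ENNReal.ofReal_mul (by positivity)]
  refine ENNReal.ofReal_le_ofReal ?_
  refine (mul_le_mul_of_nonneg_left (hP f h hh l x) (by positivity)).trans ?_
  rw [Finset.mul_sum, Finset.mul_sum]
  refine Finset.sum_le_sum fun k hk => ?_
  have := mul_le_mul_of_nonneg_left (two_rpow_weight_le (m := m) hM (Finset.mem_range.1 hk))
    (mul_nonneg hC (hpos k))
  linarith

end FarPart

namespace FarPart

variable {d : ℕ} {m : ℝ} {a : RD d → RD d → ℂ}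

lemma two_rpow_mul_ofReal_peetreFun_le {σ r : ℝ} (hσ : 0 ≤ σ) (k : ℕ) {h : RD d → ℂ} {S : ℝ≥0∞}
    (hS : ∀ y, (2 : ℝ≥0∞) ^ r * ‖h y‖ₑ ≤ S) (x : RD d) :
    (2 : ℝ≥0∞) ^ r * ENNReal.ofReal (peetreFun σ k h x) ≤ S := by
  have h2 : (2 : ℝ≥0∞) ^ r ≠ 0 := by simp
  have h3 : (2 : ℝ≥0∞) ^ r ≠ ⊤ := ENNReal.rpow_ne_top_of_ne_zero (by norm_num) (by norm_num)
  rcases eq_or_ne S ⊤ with rfl | hST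
  · exact le_top
  have h4 : ∀ y, ‖h y‖ ≤ (S / (2 : ℝ≥0∞) ^ r).toReal := fun y => by
    rw [← toReal_enorm]
    refine ENNReal.toReal_mono (ENNReal.div_ne_top hST h2) ?_
    rw [ENNReal.le_div_iff_mul_le (Or.inl h2) (Or.inl h3), mul_comm]
    exact hS y
  calc _ ≤ (2 : ℝ≥0∞) ^ r * (S / (2 : ℝ≥0∞) ^ r) :=
        mul_le_mul_right (ENNReal.ofReal_le_of_le_toReal (peetreFun_le hσ h4 x)) _
    _ = S := ENNReal.mul_div_cancel h2 h3

lemma cubeEnergy_le_of_pointwise {μ : ℕ} {n : Fin d → ℤ} {s s' q : ℝ} {g g' : ℕ → RD d → ℝ≥0∞}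
    {C A : ℝ≥0∞} (hC : C ≠ ⊤) (h : ∀ x, ∑' j : ℕ,
      ((2 : ℝ≥0∞) ^ (s * ((μ + j : ℕ) : ℝ)) * g (μ + j) x) ^ q ≤ C * (A + ∑' j : ℕ,
        ((2 : ℝ≥0∞) ^ (s' * ((μ + j : ℕ) : ℝ)) * g' (μ + j) x) ^ q)) :
    cubeEnergy d μ n s q g ≤ C * (A + cubeEnergy d μ n s' q g') := by
  unfold cubeEnergy
  refine (mul_le_mul_right (lintegral_mono h) _).trans_eq ?_
  rw [lintegral_const_mul' _ _ hC, lintegral_add_left measurable_const, setLIntegral_const,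
    mul_left_comm, mul_add, mul_left_comm, two_rpow_mul_volume_dyadicCube, mul_one]

lemma exists_cubeEnergy_Sfar_le (D : LPData d) (ha : IsSymbolS11 d m a) (s : ℝ) {q : ℝ}
    (hq : 0 < q) : ∃ C : ℝ≥0∞, C ≠ ⊤ ∧ ∀ (f : 𝓢(RD d, ℂ)) (h : ℕ → 𝓢(RD d, ℂ)),
      IsLPPieces D f h → ∀ (μ : ℕ) (n : Fin d → ℤ) (S : ℝ≥0∞),
        (∀ k < μ, ∀ x, (2 : ℝ≥0∞) ^ ((s + m) * k) * ‖h k x‖ₑ ≤ S) →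
        cubeEnergy d μ n s q (fun k x => ‖LP D k (Sfar D a f) x‖ₑ) ≤
          C * (S ^ q + ⨆ t, cubeEnergy d μ t (s + m) q (fun k x => ‖h k x‖ₑ)) := by
  obtain ⟨σ, hσ, C₁, hC₁, hav⟩ := exists_cubeEnergy_peetreFun_le D hq
  obtain ⟨C₂, hfar⟩ := exists_enorm_LP_Sfar_le D ha hσ s
  obtain ⟨C₃, hC₃, hseq⟩ := exists_tsum_rpow_le hq
  have hC₂ : (C₂ : ℝ≥0∞) ^ q ≠ ⊤ := ENNReal.rpow_ne_top_of_nonneg hq.le ENNReal.coe_ne_top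
  refine ⟨C₃ * (C₂ : ℝ≥0∞) ^ q * (1 + C₁), by finiteness, fun f h hh μ n S hS => ?_⟩
  have hmain : cubeEnergy d μ n s q (fun k x => ‖LP D k (Sfar D a f) x‖ₑ) ≤
      (C₃ * (C₂ : ℝ≥0∞) ^ q) * (S ^ q + cubeEnergy d μ n (s + m) q
        (fun k x => ENNReal.ofReal (peetreFun σ k (h k) x))) := by
    refine cubeEnergy_le_of_pointwise (by finiteness) fun x => ?_
    have h1 := hseq (fun k => C₂ * ((2 : ℝ≥0∞) ^ ((s + m) * (k : ℝ)) *
      ENNReal.ofReal (peetreFun σ k (h k) x))) _ (fun l => hfar f h hh l x) μ (C₂ * S)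
      fun k hk => mul_le_mul_right ?_ _
    · refine h1.trans_eq ?_
      simp only [ENNReal.mul_rpow_of_nonneg (C₂ : ℝ≥0∞) _ hq.le]
      rw [ENNReal.tsum_mul_left, ← mul_add, mul_assoc]
    · exact two_rpow_mul_ofReal_peetreFun_le hσ _ (hS k hk) x
  refine hmain.trans ?_
  rw [mul_assoc (C₃ * (C₂ : ℝ≥0∞) ^ q)]
  refine mul_le_mul_right ?_ _
  rw [add_mul, one_mul]
  refine add_le_add le_self_add ?_
  refine (hav (s + m) f h hh μ n).trans (mul_le_mul_right le_add_self _)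

/-- A Littlewood–Paley piece is bounded by its averages over cubes of the matching scale. -/
lemma exists_enorm_lpPiece_le (D : LPData d) {q : ℝ} (hq : 0 < q) :
    ∃ C : ℝ≥0∞, C ≠ ⊤ ∧ ∀ (r : ℝ) (f : 𝓢(RD d, ℂ)) (h : ℕ → 𝓢(RD d, ℂ)), IsLPPieces D f h →
      ∀ (k : ℕ) (x : RD d), ((2 : ℝ≥0∞) ^ (r * k) * ‖h k x‖ₑ) ^ q ≤
        C * ⨆ t, cubeEnergy d k t r q (fun k x => ‖h k x‖ₑ) := by
  obtain ⟨σ, hσ, C, hC, hav⟩ := exists_cubeEnergy_peetreFun_le D hq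
  set A := ENNReal.ofReal ((1 + d) ^ σ) with hA
  have hA' : A ^ q ≠ ⊤ := ENNReal.rpow_ne_top_of_nonneg hq.le ENNReal.ofReal_ne_top
  refine ⟨A ^ q * C, by finiteness, fun r f h hh k x => ?_⟩
  set n := cubeIndex k x with hn
  have hB := (h k).norm_le_seminorm ℝ
  have h1 : ∀ y ∈ dyadicCube d k n, ((2 : ℝ≥0∞) ^ (r * k) * ‖h k x‖ₑ) ^ q ≤
      A ^ q * ∑' j : ℕ, ((2 : ℝ≥0∞) ^ (r * ((k + j : ℕ) : ℝ)) *
        ENNReal.ofReal (peetreFun σ (k + j) (h (k + j)) y)) ^ q := by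
    intro y hy
    have h2 : ‖h k x‖ ≤ peetreFun σ k (h k) y * (1 + d) ^ σ := by
      have h3 := norm_le_peetreFun_mul (k := k) hσ hB y (y - x)
      rw [sub_sub_cancel] at h3
      refine h3.trans (mul_le_mul_of_nonneg_left ?_ (peetreFun_nonneg y))
      exact Real.rpow_le_rpow (by positivity)
        (by linarith [two_pow_mul_norm_sub_le hy (mem_dyadicCube_cubeIndex k x)]) hσ
    have h4 : ‖h k x‖ₑ ≤ A * ENNReal.ofReal (peetreFun σ k (h k) y) := by
      rw [← ofReal_norm, hA, ← ENNReal.ofReal_mul (by positivity), mul_comm]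
      exact ENNReal.ofReal_le_ofReal h2
    calc _ ≤ (A * ((2 : ℝ≥0∞) ^ (r * k) * ENNReal.ofReal (peetreFun σ k (h k) y))) ^ q := by
          rw [mul_left_comm]
          exact ENNReal.rpow_le_rpow (mul_le_mul_right h4 _) hq.le
      _ ≤ _ := by
          rw [ENNReal.mul_rpow_of_nonneg _ _ hq.le]
          exact mul_le_mul_right (ENNReal.le_tsum (f := fun j : ℕ =>
            ((2 : ℝ≥0∞) ^ (r * ((k + j : ℕ) : ℝ)) *
              ENNReal.ofReal (peetreFun σ (k + j) (h (k + j)) y)) ^ q) 0) _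
  calc ((2 : ℝ≥0∞) ^ (r * k) * ‖h k x‖ₑ) ^ q
      = (2 : ℝ≥0∞) ^ ((k : ℝ) * (d : ℝ)) *
          ∫⁻ _ in dyadicCube d k n, ((2 : ℝ≥0∞) ^ (r * k) * ‖h k x‖ₑ) ^ q := by
        rw [setLIntegral_const, mul_left_comm, two_rpow_mul_volume_dyadicCube, mul_one]
    _ ≤ (2 : ℝ≥0∞) ^ ((k : ℝ) * (d : ℝ)) * ∫⁻ y in dyadicCube d k n, A ^ q *
          ∑' j : ℕ, ((2 : ℝ≥0∞) ^ (r * ((k + j : ℕ) : ℝ)) *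
            ENNReal.ofReal (peetreFun σ (k + j) (h (k + j)) y)) ^ q :=
        mul_le_mul_right (setLIntegral_mono' (measurableSet_dyadicCube _ n) h1) _
    _ = A ^ q * cubeEnergy d k n r q
          (fun k x => ENNReal.ofReal (peetreFun σ k (h k) x)) := by
        rw [lintegral_const_mul' _ _ hA', mul_left_comm, cubeEnergy]
    _ ≤ _ := by
        rw [mul_assoc]
        exact mul_le_mul_right (hav r f h hh k n) _

lemma exists_isLPPieces (D : LPData d) (f : 𝓢(RD d, ℂ)) :
    ∃ h : ℕ → 𝓢(RD d, ℂ), IsLPPieces D f h ∧ ∀ k x, h k x = LP D k f x := by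
  choose h h1 h2 using exists_lpPiece D f
  exact ⟨h, h2, h1⟩

lemma iSup_cubeEnergy_eq {q : ℝ} (hq : 0 < q) (μ : ℕ) (s : ℝ) (g : ℕ → RD d → ℂ) :
    ⨆ t, cubeEnergy d μ t s q (fun k x => ‖g k x‖ₑ) = (⨆ t, cubePiece d μ t μ s q g) ^ q := by
  rw [← ENNReal.orderIsoRpow_apply q hq, (ENNReal.orderIsoRpow q hq).map_iSup]
  refine iSup_congr fun t => ?_
  rw [ENNReal.orderIsoRpow_apply, cubePiece_eq hq, ← ENNReal.rpow_mul, one_div_mul_cancel hq.ne',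
    ENNReal.rpow_one]

lemma exists_cubePiece_Sfar_le (D : LPData d) (ha : IsSymbolS11 d m a) (s : ℝ) {q : ℝ}
    (hq : 0 < q) : ∃ C : ℝ≥0∞, C ≠ ⊤ ∧ ∀ (f : 𝓢(RD d, ℂ)) (μ : ℕ) (n : Fin d → ℤ),
      cubePiece d μ n μ s q (fun k x => LP D k (Sfar D a f) x) ≤
        C * ((⨆ k ∈ Finset.range μ, (2 : ℝ≥0∞) ^ ((k : ℝ) * (s + m)) *
            ⨆ x : RD d, (‖LP D k f x‖₊ : ℝ≥0∞)) +
          ⨆ t : Fin d → ℤ, cubePiece d μ t μ (s + m) q (fun k x => LP D k f x)) := by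
  obtain ⟨C, hC, hmain⟩ := exists_cubeEnergy_Sfar_le D ha s hq
  refine ⟨(C * 2) ^ (1 / q), ENNReal.rpow_ne_top_of_nonneg (by positivity) (by finiteness),
    fun f μ n => ?_⟩
  obtain ⟨h, hh, hhx⟩ := exists_isLPPieces D f
  set S := ⨆ k ∈ Finset.range μ, (2 : ℝ≥0∞) ^ ((k : ℝ) * (s + m)) *
    ⨆ x : RD d, (‖LP D k f x‖₊ : ℝ≥0∞) with hS
  set Y := ⨆ t : Fin d → ℤ, cubePiece d μ t μ (s + m) q (fun k x => LP D k f x) with hY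
  have h1 := hmain f h hh μ n S fun k hk x => by
    rw [hS, mul_comm (s + m)]
    refine le_trans (mul_le_mul_right ?_ _) (le_iSup₂ (f := fun (k : ℕ) _ =>
      (2 : ℝ≥0∞) ^ ((k : ℝ) * (s + m)) * ⨆ x : RD d, (‖LP D k f x‖₊ : ℝ≥0∞)) k
      (Finset.mem_range.2 hk))
    rw [hhx]
    exact le_iSup (fun x : RD d => (‖LP D k f x‖₊ : ℝ≥0∞)) x
  simp only [hhx] at h1
  rw [iSup_cubeEnergy_eq hq μ (s + m) fun k x => LP D k f x] at h1
  rw [cubePiece_eq hq]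
  calc _ ≤ ((C * 2) * (S + Y) ^ q) ^ (1 / q) := by
        refine ENNReal.rpow_le_rpow (h1.trans ?_) (by positivity)
        rw [mul_assoc, two_mul]
        exact mul_le_mul_right (add_le_add (ENNReal.rpow_le_rpow le_self_add hq.le)
          (ENNReal.rpow_le_rpow le_add_self hq.le)) _
    _ = _ := by
        rw [ENNReal.mul_rpow_of_nonneg _ _ (by positivity), ← ENNReal.rpow_mul,
          mul_one_div_cancel hq.ne', ENNReal.rpow_one]

lemma exists_enorm_LP_le_FinftyNormFun (D : LPData d) {q : ℝ} (hq : 0 < q) :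
    ∃ C : ℝ≥0∞, C ≠ ⊤ ∧ ∀ (r : ℝ) (f : 𝓢(RD d, ℂ)) (k : ℕ) (x : RD d),
      (2 : ℝ≥0∞) ^ (r * k) * ‖LP D k f x‖ₑ ≤ C * FinftyNormFun D r q f := by
  obtain ⟨C, hC, hmain⟩ := exists_enorm_lpPiece_le D hq
  have hC' : C ^ (1 / q) ≠ ⊤ := ENNReal.rpow_ne_top_of_nonneg (by positivity) hC
  refine ⟨1 + C ^ (1 / q), by finiteness, fun r f k x => ?_⟩
  rw [add_mul, one_mul]
  rcases Nat.eq_zero_or_pos k with rfl | hk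
  · refine le_trans ?_ le_self_add
    simp only [Nat.cast_zero, mul_zero, ENNReal.rpow_zero, one_mul]
    exact (le_iSup (fun x : RD d => (‖LP D 0 f x‖₊ : ℝ≥0∞)) x).trans le_self_add
  · refine le_trans ?_ le_add_self
    obtain ⟨h, hh, hhx⟩ := exists_isLPPieces D f
    have h1 := hmain r f h hh k x
    simp only [hhx] at h1
    rw [iSup_cubeEnergy_eq hq k r fun k x => LP D k f x] at h1
    have h2 := ENNReal.rpow_le_rpow h1 (show 0 ≤ 1 / q by positivity)
    rw [ENNReal.mul_rpow_of_nonneg C _ (by positivity), ← ENNReal.rpow_mul, ← ENNReal.rpow_mul,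
      mul_one_div_cancel hq.ne', ENNReal.rpow_one, ENNReal.rpow_one] at h2
    refine h2.trans (mul_le_mul_right ?_ _)
    exact (le_iSup₂ (f := fun (μ : ℕ) (_ : 1 ≤ μ) => ⨆ n : Fin d → ℤ,
      cubePiece d μ n μ r q (fun k x => LP D k f x)) k hk).trans le_add_self

lemma exists_enorm_LP_zero_Sfar_le (D : LPData d) (ha : IsSymbolS11 d m a) (s : ℝ) :
    ∃ C : ℝ≥0, ∀ (f : 𝓢(RD d, ℂ)) (B : ℝ≥0∞),
      (∀ (k : ℕ) (x : RD d), (2 : ℝ≥0∞) ^ ((s + m) * k) * ‖LP D k f x‖ₑ ≤ B) →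
        ∀ x, ‖LP D 0 (Sfar D a f) x‖ₑ ≤ C * B := by
  obtain ⟨C, hfar⟩ := exists_enorm_LP_Sfar_le D ha le_rfl s
  refine ⟨4 * C, fun f B hB x => ?_⟩
  obtain ⟨h, hh, hhx⟩ := exists_isLPPieces D f
  have h1 := hfar f h hh 0 x
  simp only [Nat.cast_zero, mul_zero, ENNReal.rpow_zero, one_mul] at h1
  refine h1.trans ?_
  calc _ ≤ ∑ _k ∈ Finset.range (0 + 4), C * B := by
        refine Finset.sum_le_sum fun k _ => ?_
        refine (mul_le_of_le_one_left' (pow_le_one₀ zero_le (by simp))).trans ?_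
        refine mul_le_mul_right (two_rpow_mul_ofReal_peetreFun_le le_rfl k (fun y => ?_) x) _
        rw [hhx]
        exact hB k y
    _ = _ := by
        rw [Finset.sum_const, Finset.card_range, nsmul_eq_mul]
        push_cast
        ring

end FarPart

/-- the off-diagonal part `S^{far}_a` satisfies the local estimate for
every `s ∈ ℝ` (no restriction on `s`), and consequently is bounded from `F_∞^{s+m,q}`
to `F_∞^{s,q}`. -/
theorem statement11 (d : ℕ) (hd : 1 ≤ d) (m s : ℝ) (q : ℝ) (hq : 0 < q)
    (D : LPData d) (a : RD d → RD d → ℂ) (ha : IsSymbolS11 d m a) :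
    ∃ C : ℝ≥0,
      (∀ (μ : ℕ), 1 ≤ μ → ∀ (f : 𝓢(RD d, ℂ)) (n : Fin d → ℤ),
        cubePiece d μ n μ s q (fun k x => LP D k (Sfar D a f) x) ≤
          (C : ℝ≥0∞) *
            ((⨆ k ∈ Finset.range μ,
                (2:ℝ≥0∞)^((k:ℝ)*(s+m)) * ⨆ x : RD d, (‖LP D k (⇑f) x‖₊ : ℝ≥0∞)) +
              ⨆ n' : Fin d → ℤ, cubePiece d μ n' μ (s+m) q (fun k x => LP D k (⇑f) x))) ∧
      (∀ f : 𝓢(RD d, ℂ),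
        FinftyNormFun D s q (Sfar D a f) ≤ (C : ℝ≥0∞) * FinftyNormFun D (s+m) q (⇑f)) := by
  obtain ⟨C₁, hC₁, hlocal⟩ := FarPart.exists_cubePiece_Sfar_le D ha s hq
  obtain ⟨C₂, hC₂, hsup⟩ := FarPart.exists_enorm_LP_le_FinftyNormFun D hq
  obtain ⟨C₃, hlow⟩ := FarPart.exists_enorm_LP_zero_Sfar_le D ha s
  lift C₁ to ℝ≥0 using hC₁
  lift C₂ to ℝ≥0 using hC₂
  refine ⟨C₁ + (C₃ * C₂ + C₁ * (C₂ + 1)), fun μ _ f n => (hlocal f μ n).trans ?_, fun f => ?_⟩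
  · refine mul_le_mul_left ?_ _
    exact_mod_cast le_self_add
  set N := FinftyNormFun D (s + m) q f with hN
  calc FinftyNormFun D s q (Sfar D a f) ≤ C₃ * (C₂ * N) + C₁ * (C₂ * N + N) := by
        refine add_le_add (iSup_le fun x => hlow f _ (hsup (s + m) f) x)
          (iSup₂_le fun μ hμ => iSup_le fun n => (hlocal f μ n).trans ?_)
        refine mul_le_mul_right (add_le_add (iSup₂_le fun k _ => ?_) ?_) _
        · rw [ENNReal.mul_iSup, mul_comm (k : ℝ)]
          exact iSup_le fun x => hsup (s + m) f k x
        · exact (le_iSup₂ (f := fun (μ : ℕ) (_ : 1 ≤ μ) => ⨆ n : Fin d → ℤ,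
            cubePiece d μ n μ (s + m) q (fun k x => LP D k f x)) μ hμ).trans le_add_self
    _ = ((C₃ * C₂ + C₁ * (C₂ + 1) : ℝ≥0) : ℝ≥0∞) * N := by push_cast; ring
    _ ≤ _ := by
        refine mul_le_mul_left ?_ _
        exact_mod_cast le_add_self

end
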